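/- arXiv:2112.13441 — 2 statements merged into one kernel-verified Lean document; each statement's English description precedes it below -/
import Mathlib

section
/- Let K be a totally complex number field of degree 6 that is Galois over ℚ, let α₁, …, α₅ ∈ K be ℚ-linearly independent elements such that the ratios αⱼ/α_k generate K over ℚ, and let m be a nonzero integer. Then there exist a real constant C and a finite set S of triples (σ, τ, γ), where σ, τ are distinct elements of Gal(K/ℚ) and γ ∈ K is nonzero, such that every solution (x₁, …, x₅) ∈ ℤ⁵ of N_{K/ℚ}(x₁α₁ + x₂α₂ + x₃α₃ + x₄α₄ + x₅α₅) = m with max{|x₁|, …, |x₅|} > C satisfies σ(u) = γ·τ(u) for some (σ, τ, γ) ∈ S, where u = x₁α₁ + ⋯ + x₅α₅. -/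
open NumberField

section Schwarz

lemma exists_eq_pow_mul_of_le_order {f : ℂ → ℂ} (hf : Differentiable ℂ f) {x : ℂ} {M : ℕ}
    (h : (M : ℕ∞) ≤ analyticOrderAt f x) :
    ∃ k : ℂ → ℂ, Differentiable ℂ k ∧ ∀ z, f z = (z - x) ^ M * k z := by
  obtain ⟨g, hg, hfg⟩ := (natCast_le_analyticOrderAt (hf.analyticAt x)).1 h
  refine ⟨fun z => if z = x then g x else f z / (z - x) ^ M, ?_, ?_⟩
  · intro z
    by_cases hz : z = x
    · subst hz
      refine (hg.differentiableAt).congr_of_eventuallyEq ?_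
      filter_upwards [hfg] with w hw
      by_cases hwz : w = z
      · simp [hwz]
      · have : w - z ≠ 0 := sub_ne_zero.2 hwz
        simp only [hwz, if_false, hw, smul_eq_mul]
        field_simp
    · have h1 : DifferentiableAt ℂ (fun z => f z / (z - x) ^ M) z :=
        (hf z).div (by fun_prop) (pow_ne_zero _ (sub_ne_zero.2 hz))
      refine h1.congr_of_eventuallyEq ?_
      filter_upwards [isOpen_ne.mem_nhds hz] with w hw
      simp [show w ≠ x from hw]
  · intro z
    by_cases hz : z = x
    · subst hz
      have := hfg.self_of_nhds
      simpa using this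
    · have : z - x ≠ 0 := sub_ne_zero.2 hz
      simp only [hz, if_false]
      field_simp

lemma exists_eq_prod_pow_mul {f : ℂ → ℂ} (hf : Differentiable ℂ f) {M : ℕ} (s : Finset ℂ)
    (h : ∀ x ∈ s, ∃ k : ℂ → ℂ, Differentiable ℂ k ∧ ∀ z, f z = (z - x) ^ M * k z) :
    ∃ k : ℂ → ℂ, Differentiable ℂ k ∧ ∀ z, f z = (∏ x ∈ s, (z - x) ^ M) * k z := by
  classical
  induction s using Finset.induction_on with
  | empty => exact ⟨f, hf, by simp⟩
  | insert a s ha ih =>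
    obtain ⟨k, hk, hfk⟩ := ih fun x hx => h x (Finset.mem_insert_of_mem hx)
    obtain ⟨l, hl, hfl⟩ := h a (Finset.mem_insert_self a s)
    have hP : Differentiable ℂ (fun z : ℂ => ∏ x ∈ s, (z - x) ^ M) := by fun_prop
    have h1 : (M : ℕ∞) ≤ analyticOrderAt f a := by
      rw [natCast_le_analyticOrderAt (hf.analyticAt a)]
      exact ⟨l, hl.analyticAt a, Filter.Eventually.of_forall fun z => by simp [hfl z]⟩
    have h2 : analyticOrderAt (fun z : ℂ => ∏ x ∈ s, (z - x) ^ M) a = 0 := by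
      refine analyticOrderAt_eq_zero.2 (Or.inr ?_)
      refine Finset.prod_ne_zero_iff.2 fun x hx => pow_ne_zero _ (sub_ne_zero.2 ?_)
      rintro rfl
      exact ha hx
    have h3 : f = (fun z : ℂ => ∏ x ∈ s, (z - x) ^ M) * k := funext hfk
    rw [h3, analyticOrderAt_mul (hP.analyticAt a) (hk.analyticAt a), h2, zero_add] at h1
    obtain ⟨m, hm, hkm⟩ := exists_eq_pow_mul_of_le_order hk h1
    refine ⟨m, hm, fun z => ?_⟩
    rw [hfk, hkm, Finset.prod_insert ha]
    ring

/-- If all derivatives below order `M` at the points `0, …, X - 1` are small, there is a small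
entire function with the same jets there. -/
lemma exists_hermite_interpolant {f : ℂ → ℂ} (hf : Differentiable ℂ f) {X M : ℕ} {ε R : ℝ}
    (hε : ∀ x < X, ∀ m < M, ‖iteratedDeriv m f (x : ℂ)‖ ≤ ε) (hε0 : 0 ≤ ε) (hR : 1 ≤ R)
    (hX : (X : ℝ) ≤ R) :
    ∃ H : ℂ → ℂ, Differentiable ℂ H ∧
      (∀ z, ‖z‖ ≤ R → ‖H z‖ ≤ ε * (2 * R) ^ (X * M ^ 2 + 3 * M + 2)) ∧
      ∀ x < X, ∃ k : ℂ → ℂ, Differentiable ℂ k ∧ ∀ z, f z - H z = (z - (x : ℂ)) ^ M * k z := by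
  classical
  let a : ℕ → ℂ → ℂ := fun x z => ∏ y ∈ (Finset.range X).erase x, (z - y) / ((x : ℂ) - y)
  let b : ℕ → ℂ → ℂ := fun x z => 1 - (1 - a x z ^ M) ^ M
  let J : ℕ → ℂ → ℂ := fun x z =>
    ∑ m ∈ Finset.range M, iteratedDeriv m f (x : ℂ) * (z - x) ^ m / m.factorial
  have ha : ∀ x, Differentiable ℂ (a x) := fun x => by
    simp only [a]; fun_prop
  have hJ : ∀ x, Differentiable ℂ (J x) := fun x => by
    simp only [J]; fun_prop
  have hb : ∀ x, Differentiable ℂ (b x) := fun x => by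
    have := ha x
    simp only [b]; fun_prop
  have h2R : 1 ≤ 2 * R := by linarith
  have hsub : ∀ x < X, ∀ z : ℂ, ‖z‖ ≤ R → ‖z - x‖ ≤ 2 * R := fun x hx z hz => by
    have h1 : ‖(x : ℂ)‖ ≤ R := by
      rw [Complex.norm_natCast]; exact le_trans (by exact_mod_cast hx.le) hX
    linarith [norm_sub_le z x]
  have habd : ∀ x < X, ∀ z : ℂ, ‖z‖ ≤ R → ‖a x z‖ ≤ (2 * R) ^ X := fun x hx z hz => by
    simp only [a, norm_prod]
    calc ∏ y ∈ (Finset.range X).erase x, ‖(z - y) / ((x : ℂ) - y)‖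
        ≤ ∏ y ∈ (Finset.range X).erase x, (2 * R) := by
          refine Finset.prod_le_prod (fun _ _ => norm_nonneg _) fun y hy => ?_
          have hy' := Finset.mem_erase.1 hy
          rw [norm_div]
          have h1 : 1 ≤ ‖(x : ℂ) - y‖ := by
            have : ((x : ℂ) - y) = (((x : ℤ) - (y : ℤ) : ℤ) : ℂ) := by push_cast; ring
            rw [this, Complex.norm_intCast]
            have h3 : (x : ℤ) - y ≠ 0 := by have := hy'.1; omega
            exact_mod_cast Int.one_le_abs h3
          have h4 := hsub y (Finset.mem_range.1 hy'.2) z hz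
          exact (div_le_self (norm_nonneg _) h1).trans h4
      _ = (2 * R) ^ ((Finset.range X).erase x).card := by simp
      _ ≤ (2 * R) ^ X := by
          refine pow_le_pow_right₀ h2R ?_
          exact (Finset.card_le_card (Finset.erase_subset _ _)).trans (by simp)
  have hbbd : ∀ x < X, ∀ z : ℂ, ‖z‖ ≤ R → ‖b x z‖ ≤ (2 * R) ^ (X * M ^ 2 + M + 1) :=
    fun x hx z hz => by
    have h1 : ‖a x z ^ M‖ ≤ (2 * R) ^ (X * M) := by
      rw [norm_pow, pow_mul]; gcongr; exact habd x hx z hz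
    have h2 : ‖1 - a x z ^ M‖ ≤ (2 * R) ^ (X * M + 1) := by
      have := norm_sub_le 1 (a x z ^ M)
      rw [norm_one] at this
      have h5 : 1 ≤ (2 * R) ^ (X * M) := one_le_pow₀ h2R
      rw [pow_succ]
      nlinarith
    have h3 : ‖(1 - a x z ^ M) ^ M‖ ≤ (2 * R) ^ (X * M ^ 2 + M) := by
      rw [norm_pow, show X * M ^ 2 + M = (X * M + 1) * M by ring, pow_mul]; gcongr
    have := norm_sub_le 1 ((1 - a x z ^ M) ^ M)
    rw [norm_one] at this
    have h5 : 1 ≤ (2 * R) ^ (X * M ^ 2 + M) := one_le_pow₀ h2R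
    rw [pow_succ]
    simp only [b]
    nlinarith
  have hJbd : ∀ x < X, ∀ z : ℂ, ‖z‖ ≤ R → ‖J x z‖ ≤ ε * (2 * R) ^ (2 * M) :=
    fun x hx z hz => by
    calc ‖J x z‖ ≤ ∑ m ∈ Finset.range M,
          ‖iteratedDeriv m f (x : ℂ) * (z - x) ^ m / m.factorial‖ := norm_sum_le _ _
      _ ≤ ∑ m ∈ Finset.range M, ε * (2 * R) ^ M := by
          refine Finset.sum_le_sum fun m hm => ?_
          have hm' := Finset.mem_range.1 hm
          rw [norm_div, norm_mul, norm_pow, Complex.norm_natCast]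
          have h1 : (1 : ℝ) ≤ m.factorial := by exact_mod_cast Nat.factorial_pos m
          refine (div_le_self (by positivity) h1).trans ?_
          gcongr
          · exact hε x hx m hm'
          · calc ‖z - x‖ ^ m ≤ (2 * R) ^ m := by gcongr; exact hsub x hx z hz
              _ ≤ (2 * R) ^ M := pow_le_pow_right₀ h2R hm'.le
      _ = M * (ε * (2 * R) ^ M) := by simp
      _ ≤ (2 * R) ^ M * (ε * (2 * R) ^ M) := by
          gcongr
          calc (M : ℝ) ≤ 2 ^ M := by exact_mod_cast (Nat.lt_two_pow_self).le
            _ ≤ (2 * R) ^ M := by gcongr; linarith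
      _ = ε * (2 * R) ^ (2 * M) := by ring
  refine ⟨fun z => ∑ x ∈ Finset.range X, b x z * J x z, by fun_prop, ?_, ?_⟩
  · intro z hz
    calc ‖∑ x ∈ Finset.range X, b x z * J x z‖
        ≤ ∑ x ∈ Finset.range X, (2 * R) ^ (X * M ^ 2 + M + 1) * (ε * (2 * R) ^ (2 * M)) := by
          refine norm_sum_le_of_le _ fun x hx => ?_
          have hx' := Finset.mem_range.1 hx
          rw [norm_mul]
          gcongr
          · exact hbbd x hx' z hz
          · exact hJbd x hx' z hz
      _ = X * ((2 * R) ^ (X * M ^ 2 + M + 1) * (ε * (2 * R) ^ (2 * M))) := by simp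
      _ ≤ (2 * R) * ((2 * R) ^ (X * M ^ 2 + M + 1) * (ε * (2 * R) ^ (2 * M))) := by
          gcongr; linarith
      _ = _ := by ring
  · intro x hx
    have h1 : ∃ k : ℂ → ℂ, Differentiable ℂ k ∧ ∀ z, f z - J x z = (z - (x : ℂ)) ^ M * k z := by
      apply exists_eq_pow_mul_of_le_order (f := fun z => f z - J x z) (hf.sub (hJ x))
      refine (natCast_le_analyticOrderAt_iff_iteratedDeriv_eq_zero (f := fun z => f z - J x z)
        ((hf.fun_sub (hJ x)).analyticAt _)).2 ?_
      intro i hi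
      have e1 : (fun z => f z - J x z) = f - J x := rfl
      rw [e1, iteratedDeriv_sub (hf.contDiff.contDiffAt) ((hJ x).contDiff.contDiffAt)]
      have e2 : iteratedDeriv i (J x) (x : ℂ) = iteratedDeriv i f (x : ℂ) := by
        have e3 : J x = fun z => (fun w => ∑ m ∈ Finset.range M,
            (iteratedDeriv m f (x : ℂ) / m.factorial) * w ^ m) (z - x) := by
          funext z; simp only [J]; exact Finset.sum_congr rfl fun m _ => by ring
        rw [e3, congrFun (iteratedDeriv_comp_sub_const i (fun w => ∑ m ∈ Finset.range M,
            (iteratedDeriv m f (x : ℂ) / m.factorial) * w ^ m) (x : ℂ)) (x : ℂ)]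
        simp only [sub_self]
        rw [iteratedDeriv_fun_sum (fun j _ => by fun_prop)]
        rw [Finset.sum_eq_single i]
        · rw [iteratedDeriv_const_mul_field, iteratedDeriv_fun_pow_zero]
          have : (i.factorial : ℂ) ≠ 0 := by exact_mod_cast i.factorial_ne_zero
          simp [this]
        · intro m _ hmi
          rw [iteratedDeriv_const_mul_field, iteratedDeriv_fun_pow_zero]
          simp [hmi.symm]
        · intro h; exact absurd (Finset.mem_range.2 hi) h
      rw [e2, sub_self]
    have h2 : ∃ k : ℂ → ℂ, Differentiable ℂ k ∧ ∀ z, 1 - b x z = (z - (x : ℂ)) ^ M * k z := by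
      have hd : Differentiable ℂ (fun z => 1 - a x z ^ M) := by
        have := ha x
        fun_prop
      obtain ⟨k, hk, h⟩ := exists_eq_pow_mul_of_le_order (f := fun z => 1 - a x z ^ M)
        (x := (x : ℂ)) (M := 1) hd (by
          rw [natCast_le_analyticOrderAt_iff_iteratedDeriv_eq_zero (hd.analyticAt _)]
          intro i hi
          obtain rfl : i = 0 := by omega
          have : a x (x : ℂ) = 1 := by
            refine Finset.prod_eq_one fun y hy => div_self ?_
            have := (Finset.mem_erase.1 hy).1
            exact sub_ne_zero.2 (by exact_mod_cast this.symm)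
          simp [this])
      refine ⟨fun z => k z ^ M, by fun_prop, fun z => ?_⟩
      simp only [b, sub_sub_cancel]
      rw [h z, pow_one, mul_pow]
    have h3 : ∀ y ∈ (Finset.range X).erase x, ∃ k : ℂ → ℂ, Differentiable ℂ k ∧
        ∀ z, b y z = (z - (x : ℂ)) ^ M * k z := by
      intro y hy
      have hy' := Finset.mem_erase.1 hy
      have h4 : ∃ k : ℂ → ℂ, Differentiable ℂ k ∧ ∀ z, a y z = (z - (x : ℂ)) * k z := by
        refine ⟨fun z => (∏ w ∈ ((Finset.range X).erase y).erase x,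
          (z - w) / ((y : ℂ) - w)) / ((y : ℂ) - x), by fun_prop, fun z => ?_⟩
        have hxy : x ∈ (Finset.range X).erase y :=
          Finset.mem_erase.2 ⟨hy'.1.symm, Finset.mem_range.2 hx⟩
        simp only [a]
        rw [← Finset.mul_prod_erase _ _ hxy]
        ring
      obtain ⟨k, hk, h⟩ := h4
      refine ⟨fun z => k z ^ M * ∑ i ∈ Finset.range M, (1 - a y z ^ M) ^ i, ?_, fun z => ?_⟩
      · have := ha y
        fun_prop
      · have := mul_neg_geom_sum (1 - a y z ^ M) M
        have hM : a y z ^ M = (z - x) ^ M * k z ^ M := by rw [h z, mul_pow]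
        simp only [b]
        rw [← this, sub_sub_cancel]
        nth_rewrite 1 [hM]
        ring
    obtain ⟨k1, hk1, e1⟩ := h1
    obtain ⟨k2, hk2, e2⟩ := h2
    choose! k3 hk3 e3 using h3
    refine ⟨fun z => k1 z + J x z * k2 z - ∑ y ∈ (Finset.range X).erase x, k3 y z * J y z,
      ?_, fun z => ?_⟩
    · have : Differentiable ℂ (fun z => ∑ y ∈ (Finset.range X).erase x, k3 y z * J y z) :=
        Differentiable.fun_sum fun y hy => (hk3 y hy).mul (hJ y)
      exact (hk1.add ((hJ x).mul hk2)).sub this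
    · beta_reduce
      rw [← Finset.add_sum_erase _ _ (Finset.mem_range.2 hx), mul_sub, mul_add,
        Finset.mul_sum (f := fun y => k3 y z * J y z), ← e1 z, mul_left_comm, ← e2 z]
      have : ∑ y ∈ (Finset.range X).erase x, (z - (x : ℂ)) ^ M * (k3 y z * J y z)
          = ∑ y ∈ (Finset.range X).erase x, b y z * J y z :=
        Finset.sum_congr rfl fun y hy => by rw [e3 y hy z]; ring
      rw [this]; ring

/-- A Schwarz lemma for entire functions almost vanishing to order `M` at `0, …, X - 1`. -/
lemma norm_le_of_almost_vanishing {f : ℂ → ℂ} (hf : Differentiable ℂ f) {X M : ℕ} {ε r B : ℝ}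
    (hε : ∀ x < X, ∀ m < M, ‖iteratedDeriv m f (x : ℂ)‖ ≤ ε) (hε0 : 0 ≤ ε) (hr : 1 ≤ r)
    (hX : (X : ℝ) ≤ r) (hB : ∀ z, ‖z‖ ≤ 7 * r → ‖f z‖ ≤ B) {z : ℂ} (hz : ‖z‖ ≤ r) :
    ‖f z‖ ≤ (B + ε * (14 * r) ^ (X * M ^ 2 + 3 * M + 2)) * (1 / 3) ^ (X * M)
      + ε * (14 * r) ^ (X * M ^ 2 + 3 * M + 2) := by
  classical
  obtain ⟨H, hH, hHb, hHk⟩ := exists_hermite_interpolant hf hε hε0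
    (show 1 ≤ 7 * r by linarith) (by linarith)
  rw [show 2 * (7 * r) = 14 * r by ring] at hHb
  set E := ε * (14 * r) ^ (X * M ^ 2 + 3 * M + 2) with hE
  have hinj : Set.InjOn (fun n : ℕ => (n : ℂ)) (Finset.range X) := by
    intro a _ b _ h
    exact Nat.cast_injective h
  obtain ⟨k, hk, hfk⟩ := exists_eq_prod_pow_mul (f := fun z => f z - H z) (M := M) (hf.sub hH)
    ((Finset.range X).image (fun n : ℕ => (n : ℂ))) (by
      intro x hx
      obtain ⟨n, hn, rfl⟩ := Finset.mem_image.1 hx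
      exact hHk n (Finset.mem_range.1 hn))
  simp only [Finset.prod_image hinj] at hfk
  have hlow : ∀ w : ℂ, ‖w‖ = 7 * r → (6 * r) ^ (X * M) ≤ ‖∏ x ∈ Finset.range X, (w - x) ^ M‖ := by
    intro w hw
    rw [norm_prod, mul_comm X M, pow_mul]
    calc ((6 * r) ^ M) ^ X = ∏ x ∈ Finset.range X, (6 * r) ^ M := by simp
      _ ≤ _ := by
        refine Finset.prod_le_prod (fun _ _ => by positivity) fun x hx => ?_
        rw [norm_pow]
        gcongr
        have h1 : ‖(x : ℂ)‖ ≤ r := by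
          rw [Complex.norm_natCast]
          exact le_trans (by exact_mod_cast (Finset.mem_range.1 hx).le) hX
        have := norm_sub_norm_le w x
        linarith
  have hupp : ‖∏ x ∈ Finset.range X, (z - x) ^ M‖ ≤ (2 * r) ^ (X * M) := by
    rw [norm_prod, mul_comm X M, pow_mul]
    calc _ ≤ ∏ x ∈ Finset.range X, (2 * r) ^ M := by
          refine Finset.prod_le_prod (fun _ _ => by positivity) fun x hx => ?_
          rw [norm_pow]
          gcongr
          have h1 : ‖(x : ℂ)‖ ≤ r := by
            rw [Complex.norm_natCast]
            exact le_trans (by exact_mod_cast (Finset.mem_range.1 hx).le) hX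
          have := norm_sub_le z x
          linarith
      _ = ((2 * r) ^ M) ^ X := by simp
  have hkb : ‖k z‖ ≤ (B + E) / (6 * r) ^ (X * M) := by
    refine Complex.norm_le_of_forall_mem_frontier_norm_le (U := Metric.ball 0 (7 * r))
      Metric.isBounded_ball hk.diffContOnCl (fun w hw => ?_) (subset_closure ?_)
    · rw [frontier_ball _ (by linarith), mem_sphere_zero_iff_norm] at hw
      rw [le_div_iff₀ (by positivity)]
      calc ‖k w‖ * (6 * r) ^ (X * M) ≤ ‖k w‖ * ‖∏ x ∈ Finset.range X, (w - x) ^ M‖ := by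
            gcongr; exact hlow w hw
        _ = ‖f w - H w‖ := by rw [hfk w, norm_mul, mul_comm]
        _ ≤ B + E := (norm_sub_le _ _).trans (add_le_add (hB w hw.le) (hHb w hw.le))
    · rw [mem_ball_zero_iff]; linarith
  have h1 : ‖f z - H z‖ ≤ (B + E) * (1 / 3) ^ (X * M) := by
    rw [hfk z, norm_mul]
    calc _ ≤ (2 * r) ^ (X * M) * ((B + E) / (6 * r) ^ (X * M)) := by gcongr
      _ = (B + E) * ((2 * r) / (6 * r)) ^ (X * M) := by rw [div_pow]; ring
      _ = _ := by
        congr 2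
        field_simp
        norm_num
  have h2 := hHb z (by linarith)
  calc ‖f z‖ = ‖(f z - H z) + H z‖ := by ring_nf
    _ ≤ _ := (norm_add_le _ _).trans (add_le_add h1 h2)

end Schwarz

section ExpSum

/-- The exponential polynomial `∑ aᵢ uᵢ ^ t₁ vᵢ ^ t₂ exp ((uᵢ ξ + vᵢ θ) z)`. -/
noncomputable def expSum {ι : Type*} [Fintype ι] (a : ι → ℂ) (u v : ι → ℤ) (ξ θ : ℂ)
    (t₁ t₂ : ℕ) (z : ℂ) : ℂ :=
  ∑ i, a i * (u i : ℂ) ^ t₁ * (v i : ℂ) ^ t₂ * Complex.exp ((u i * ξ + v i * θ) * z)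

variable {ι : Type*} [Fintype ι] {a : ι → ℂ} {u v : ι → ℤ} {ξ θ : ℂ}

lemma differentiable_expSum (t₁ t₂ : ℕ) : Differentiable ℂ (expSum a u v ξ θ t₁ t₂) := by
  unfold expSum
  fun_prop

lemma iteratedDeriv_expSum (t₁ t₂ m : ℕ) (z : ℂ) :
    iteratedDeriv m (expSum a u v ξ θ t₁ t₂) z =
      ∑ j ∈ Finset.range (m + 1),
        ξ ^ j * θ ^ (m - j) * m.choose j * expSum a u v ξ θ (t₁ + j) (t₂ + (m - j)) z := by
  unfold expSum
  rw [iteratedDeriv_fun_sum (fun j _ => by fun_prop)]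
  simp only [Finset.mul_sum]
  rw [Finset.sum_comm]
  refine Finset.sum_congr rfl fun i _ => ?_
  rw [iteratedDeriv_const_mul_field]
  have : iteratedDeriv m (fun x => Complex.exp ((u i * ξ + v i * θ) * x)) z
      = (u i * ξ + v i * θ) ^ m * Complex.exp ((u i * ξ + v i * θ) * z) := by
    rw [iteratedDeriv_cexp_const_mul]
  rw [this, add_pow, Finset.sum_mul, Finset.mul_sum]
  refine Finset.sum_congr rfl fun j _ => ?_
  ring

lemma norm_iteratedDeriv_expSum_le {t₁ t₂ m M : ℕ} {z : ℂ} {δ : ℝ}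
    (h : ∀ s₁ < 2 * M, ∀ s₂ < 2 * M, ‖expSum a u v ξ θ s₁ s₂ z‖ ≤ δ)
    (h₁ : t₁ < M) (h₂ : t₂ < M) (hm : m < M) :
    ‖iteratedDeriv m (expSum a u v ξ θ t₁ t₂) z‖ ≤ (‖ξ‖ + ‖θ‖) ^ m * δ := by
  rw [iteratedDeriv_expSum, add_pow, Finset.sum_mul]
  refine norm_sum_le_of_le _ fun j hj => ?_
  have hj' := Finset.mem_range.1 hj
  rw [norm_mul, norm_mul, norm_mul, norm_pow, norm_pow, Complex.norm_natCast]
  gcongr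
  exact h _ (by omega) _ (by omega)

lemma norm_expSum_le {t₁ t₂ : ℕ} {z : ℂ} {α U W : ℝ} (ha : ∀ i, ‖a i‖ ≤ α)
    (hu : ∀ i, |(u i : ℝ)| ≤ U) (hv : ∀ i, |(v i : ℝ)| ≤ U)
    (hw : ∀ i, ‖u i * ξ + v i * θ‖ ≤ W) :
    ‖expSum a u v ξ θ t₁ t₂ z‖ ≤ Fintype.card ι * (α * U ^ (t₁ + t₂) * Real.exp (W * ‖z‖)) := by
  calc ‖expSum a u v ξ θ t₁ t₂ z‖ ≤ ∑ i : ι, α * U ^ (t₁ + t₂) * Real.exp (W * ‖z‖) := by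
        refine norm_sum_le_of_le _ fun i _ => ?_
        have hU : 0 ≤ U := (abs_nonneg _).trans (hu i)
        have hα : 0 ≤ α := (norm_nonneg _).trans (ha i)
        rw [norm_mul, norm_mul, norm_mul, norm_pow, norm_pow, Complex.norm_intCast,
          Complex.norm_intCast, Complex.norm_exp, pow_add, ← mul_assoc]
        gcongr
        · exact ha i
        · exact hu i
        · exact hv i
        · refine (Complex.re_le_norm _).trans ?_
          rw [norm_mul]
          gcongr
          exact hw i
    _ = _ := by simp

/-- Extrapolation for exponential polynomials. -/
lemma norm_expSum_le_of_almost_vanishing {X M : ℕ} {δ r α U W : ℝ}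
    (h : ∀ x < X, ∀ s₁ < 2 * M, ∀ s₂ < 2 * M, ‖expSum a u v ξ θ s₁ s₂ x‖ ≤ δ)
    (hδ : 0 ≤ δ) (hr : 1 ≤ r) (hX : (X : ℝ) ≤ r) (ha : ∀ i, ‖a i‖ ≤ α)
    (hu : ∀ i, |(u i : ℝ)| ≤ U) (hv : ∀ i, |(v i : ℝ)| ≤ U) (hU : 1 ≤ U)
    (hw : ∀ i, ‖u i * ξ + v i * θ‖ ≤ W) (hα : 0 ≤ α) (hW : 0 ≤ W) (hξ : 1 ≤ ‖ξ‖ + ‖θ‖)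
    {t₁ t₂ : ℕ} (h₁ : t₁ < M) (h₂ : t₂ < M) {z : ℂ} (hz : ‖z‖ ≤ r) :
    ‖expSum a u v ξ θ t₁ t₂ z‖ ≤
      (Fintype.card ι * (α * U ^ (2 * M) * Real.exp (W * (7 * r)))
        + (‖ξ‖ + ‖θ‖) ^ M * δ * (14 * r) ^ (X * M ^ 2 + 3 * M + 2)) * (1 / 3) ^ (X * M)
      + (‖ξ‖ + ‖θ‖) ^ M * δ * (14 * r) ^ (X * M ^ 2 + 3 * M + 2) := by
  refine norm_le_of_almost_vanishing (differentiable_expSum t₁ t₂) (fun x hx m hm => ?_)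
    (by positivity) hr hX (fun w hw' => ?_) hz
  · refine (norm_iteratedDeriv_expSum_le (h x hx) h₁ h₂ hm).trans ?_
    gcongr
  · refine (norm_expSum_le ha hu hv hw).trans ?_
    gcongr
    omega

end ExpSum

section Vandermonde

/-- Vanishing power sums split according to the values of the base. -/
lemma sum_filter_eq_zero_of_power_sums {ι F : Type*} [Field F] [DecidableEq F] (s : Finset ι)
    (a w : ι → F) {N : ℕ} (hN : (s.image w).card ≤ N)
    (h : ∀ x < N, ∑ i ∈ s, a i * w i ^ x = 0) (c : F) :
    ∑ i ∈ s with w i = c, a i = 0 := by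
  by_cases hc : c ∈ s.image w
  swap
  · rw [Finset.filter_eq_empty_iff.2, Finset.sum_empty]
    intro i hi hic
    exact hc (hic ▸ Finset.mem_image_of_mem w hi)
  let p : Polynomial F := ∏ d ∈ (s.image w).erase c, (Polynomial.X - Polynomial.C d)
  have hdeg : p.natDegree < N := by
    simp only [p]
    rw [Polynomial.natDegree_finsetProd_X_sub_C_eq_card, Finset.card_erase_of_mem hc]
    have := Finset.card_pos.2 ⟨c, hc⟩
    omega
  have hp : ∑ i ∈ s, a i * p.eval (w i) = 0 := by
    simp only [Polynomial.eval_eq_sum_range' hdeg, Finset.mul_sum]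
    rw [Finset.sum_comm]
    refine Finset.sum_eq_zero fun x hx => ?_
    have := h x (Finset.mem_range.1 hx)
    calc ∑ i ∈ s, a i * (p.coeff x * w i ^ x) = p.coeff x * ∑ i ∈ s, a i * w i ^ x := by
          rw [Finset.mul_sum]; exact Finset.sum_congr rfl fun i _ => by ring
      _ = 0 := by rw [this, mul_zero]
  have hpc : p.eval c ≠ 0 := by
    simp only [p, Polynomial.eval_prod, Polynomial.eval_sub, Polynomial.eval_X,
      Polynomial.eval_C]
    exact Finset.prod_ne_zero_iff.2 fun d hd => sub_ne_zero.2 (Finset.mem_erase.1 hd).1.symm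
  have h1 : ∑ i ∈ s, a i * p.eval (w i) = p.eval c * ∑ i ∈ s with w i = c, a i := by
    rw [Finset.sum_filter, Finset.mul_sum]
    refine Finset.sum_congr rfl fun i hi => ?_
    split_ifs with hic
    · rw [hic, mul_comm]
    · have : p.eval (w i) = 0 := by
        simp only [p, Polynomial.eval_prod, Polynomial.eval_sub, Polynomial.eval_X,
          Polynomial.eval_C]
        exact Finset.prod_eq_zero
          (Finset.mem_erase.2 ⟨hic, Finset.mem_image_of_mem w hi⟩) (sub_self _)
      rw [this, mul_zero, mul_zero]
  rw [h1] at hp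
  exact (mul_eq_zero.1 hp).resolve_left hpc

/-- The zero estimate. -/
lemma eq_zero_of_exponential_sums {F : Type*} [Field F] [CharZero F] {S L T X : ℕ} {n k : ℤ}
    (ξ : Fin S × Fin S × Fin L → F) {η γ : F} (hη : ∀ m : ℕ, 0 < m → η ^ m ≠ 1) (hη0 : η ≠ 0)
    (hγ : γ ≠ 0) (hn : (S : ℤ) ≤ n) (hTS : S ≤ T) (hTL : L ≤ T) (hX : S * L ≤ X)
    (h : ∀ t₁ < T, ∀ t₂ < T, ∀ x < X, ∑ i, ξ i * (((i.1 : ℤ) + i.2.2 * n : ℤ) : F) ^ t₁ *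
      (((i.2.1 : ℤ) - k * i.2.2 : ℤ) : F) ^ t₂ * (η ^ (i.1 : ℕ) * γ ^ (i.2.2 : ℕ)) ^ x = 0) :
    ξ = 0 := by
  classical
  funext i₀
  have hinj : ∀ a b : Fin S, η ^ (a : ℕ) = η ^ (b : ℕ) → a = b := by
    have key : ∀ a b : ℕ, a < b → η ^ a ≠ η ^ b := by
      intro a b hab e
      refine hη (b - a) (by omega) ?_
      have : η ^ b = η ^ a * η ^ (b - a) := by rw [← pow_add]; congr 1; omega
      rw [this] at e
      exact (mul_left_cancel₀ (pow_ne_zero a hη0) ((mul_one _).trans e)).symm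
    intro a b e
    rcases lt_trichotomy (a : ℕ) b with hab | hab | hab
    · exact absurd e (key _ _ hab)
    · exact Fin.ext hab
    · exact absurd e.symm (key _ _ hab)
  set w : Fin S × Fin S × Fin L → F := fun i => η ^ (i.1 : ℕ) * γ ^ (i.2.2 : ℕ) with hw
  set u : Fin S × Fin S × Fin L → F := fun i => (((i.1 : ℤ) + i.2.2 * n : ℤ) : F) with hu
  set v : Fin S × Fin S × Fin L → F := fun i => (((i.2.1 : ℤ) - k * i.2.2 : ℤ) : F) with hv
  set s₁ := Finset.univ.filter fun i => w i = w i₀ with hs₁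
  set s₂ := s₁.filter fun i => u i = u i₀ with hs₂
  have h1 : ∀ t₁ < T, ∀ t₂ < T, ∑ i ∈ s₁, ξ i * u i ^ t₁ * v i ^ t₂ = 0 := by
    intro t₁ ht₁ t₂ ht₂
    refine sum_filter_eq_zero_of_power_sums Finset.univ (fun i => ξ i * u i ^ t₁ * v i ^ t₂) w
      (N := X) (le_trans ?_ hX) (fun x hx => h t₁ ht₁ t₂ ht₂ x hx) _
    have : (Finset.univ : Finset (Fin S × Fin S × Fin L)).image w ⊆
        (Finset.univ : Finset (Fin S × Fin L)).image (fun i => η ^ (i.1 : ℕ) * γ ^ (i.2 : ℕ)) := by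
      intro y hy
      obtain ⟨i, -, rfl⟩ := Finset.mem_image.1 hy
      exact Finset.mem_image.2 ⟨(i.1, i.2.2), Finset.mem_univ _, rfl⟩
    refine (Finset.card_le_card this).trans (Finset.card_image_le.trans ?_)
    simp
  have hl : ∀ i ∈ s₁, ∀ j ∈ s₁, i.2.2 = j.2.2 → i.1 = j.1 := by
    intro i hi j hj hij
    have e : w i = w j := (Finset.mem_filter.1 hi).2.trans (Finset.mem_filter.1 hj).2.symm
    simp only [hw, hij] at e
    exact hinj _ _ (mul_right_cancel₀ (pow_ne_zero _ hγ) e)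
  have h2 : ∀ t₂ < T, ∑ i ∈ s₂, ξ i * v i ^ t₂ = 0 := by
    intro t₂ ht₂
    refine sum_filter_eq_zero_of_power_sums s₁ (fun i => ξ i * v i ^ t₂) u
      (N := T) (le_trans ?_ hTL) (fun t ht => ?_) _
    · have e : s₁.image u = (s₁.image fun i => (i.1, i.2.2)).image
          (fun i : Fin S × Fin L => (((i.1 : ℤ) + i.2 * n : ℤ) : F)) := by
        rw [Finset.image_image]; rfl
      rw [e]
      refine Finset.card_image_le.trans ?_
      have := Finset.card_le_card_of_injOn (s := s₁.image fun i => (i.1, i.2.2))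
        (t := (Finset.univ : Finset (Fin L))) (fun i => i.2) (fun _ _ => Finset.mem_univ _) ?_
      · simpa using this
      · intro a ha b hb hab
        obtain ⟨i, hi, rfl⟩ := Finset.mem_image.1 (Finset.mem_coe.1 ha)
        obtain ⟨j, hj, rfl⟩ := Finset.mem_image.1 (Finset.mem_coe.1 hb)
        exact Prod.ext (hl i hi j hj hab) hab
    · rw [← h1 t ht t₂ ht₂]
      exact Finset.sum_congr rfl fun i _ => by ring
  have hs₂' : ∀ i ∈ s₂, i.1 = i₀.1 ∧ i.2.2 = i₀.2.2 := by
    intro i hi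
    have e : u i = u i₀ := (Finset.mem_filter.1 hi).2
    simp only [hu] at e
    have e' := Int.cast_injective e
    have b1 := i.1.isLt
    have b2 := i₀.1.isLt
    have : (i.2.2 : ℕ) = (i₀.2.2 : ℕ) := by
      by_contra hne
      rcases lt_or_gt_of_ne hne with hlt | hlt
      · have : (1 : ℤ) * n ≤ ((i₀.2.2 : ℕ) - (i.2.2 : ℕ) : ℤ) * n :=
          mul_le_mul_of_nonneg_right (by omega) (by omega)
        have : ((i₀.2.2 : ℕ) - (i.2.2 : ℕ) : ℤ) * n = (i.1 : ℕ) - (i₀.1 : ℕ) := by linarith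
        omega
      · have : (1 : ℤ) * n ≤ ((i.2.2 : ℕ) - (i₀.2.2 : ℕ) : ℤ) * n :=
          mul_le_mul_of_nonneg_right (by omega) (by omega)
        have : ((i.2.2 : ℕ) - (i₀.2.2 : ℕ) : ℤ) * n = (i₀.1 : ℕ) - (i.1 : ℕ) := by linarith
        omega
    rw [this] at e'
    exact ⟨Fin.ext (by omega), Fin.ext this⟩
  have h3 : ∑ i ∈ s₂ with v i = v i₀, ξ i = 0 := by
    refine sum_filter_eq_zero_of_power_sums s₂ ξ v (N := T) (le_trans ?_ hTS) h2 _
    refine Finset.card_image_le.trans ?_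
    have := Finset.card_le_card_of_injOn (s := s₂)
        (t := (Finset.univ : Finset (Fin S))) (fun i => i.2.1) (fun _ _ => Finset.mem_univ _) ?_
    · simpa using this
    · intro i hi j hj hij
      have h1 := hs₂' i (Finset.mem_coe.1 hi)
      have h2 := hs₂' j (Finset.mem_coe.1 hj)
      exact Prod.ext (h1.1.trans h2.1.symm) (Prod.ext hij (h1.2.trans h2.2.symm))
  have h4 : (s₂.filter fun i => v i = v i₀) = {i₀} := by
    ext i
    simp only [Finset.mem_filter, Finset.mem_singleton]
    constructor
    · rintro ⟨hi, hvi⟩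
      have h1 := hs₂' i hi
      simp only [hv] at hvi
      have e' := Int.cast_injective hvi
      rw [h1.2] at e'
      exact Prod.ext h1.1 (Prod.ext (Fin.ext (by omega)) h1.2)
    · rintro rfl
      simp [hs₂, hs₁]
  rw [h4, Finset.sum_singleton] at h3
  exact h3

end Vandermonde

section Arithmetic

variable {K : Type*} [Field K] [NumberField K]

lemma one_le_norm_mul_pow_of_house_le {x : 𝓞 K} (hx : x ≠ 0) (φ : K →+* ℂ) {H : ℝ}
    (hH : house (x : K) ≤ H) : 1 ≤ ‖φ x‖ * H ^ Module.finrank ℚ K := by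
  have hx' : (x : K) ≠ 0 := by simpa using hx
  have h1 : 1 ≤ house (x : K) := one_le_house_of_isIntegral (RingOfIntegers.isIntegral_coe x) hx'
  have h2 := norm_norm_le_norm_mul_house_pow (x : K) φ
  have h3 : (1 : ℝ) ≤ ‖Algebra.norm ℚ (x : K)‖ := by
    have e : Algebra.norm ℚ (x : K) = ((Algebra.norm ℤ x : ℤ) : ℚ) := by
      rw [Algebra.coe_norm_int]
    have h4 : Algebra.norm ℤ x ≠ 0 := Algebra.norm_ne_zero_iff.2 hx
    rw [e]
    have h5 := Int.one_le_abs h4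
    rw [← Rat.norm_cast_real, Rat.cast_intCast, Real.norm_eq_abs]
    exact_mod_cast h5
  calc (1 : ℝ) ≤ ‖φ x‖ * house (x : K) ^ (Module.finrank ℚ K - 1) := h3.trans h2
    _ ≤ ‖φ x‖ * house (x : K) ^ Module.finrank ℚ K := by
      gcongr
      omega
    _ ≤ _ := by
      gcongr

lemma exists_siegel_const (K : Type*) [Field K] [NumberField K] :
    ∃ c : ℝ, 1 ≤ c ∧ ∀ {α β : Type} [Fintype α] [Fintype β] (a : Matrix α β (𝓞 K)) (A : ℝ),
      a ≠ 0 → 0 < Fintype.card α → 2 * Fintype.card α ≤ Fintype.card β → 1 ≤ A →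
      (∀ k l, house (a k l : K) ≤ A) →
      ∃ ξ : β → 𝓞 K, ξ ≠ 0 ∧ a.mulVec ξ = 0 ∧
        ∀ l, house (ξ l : K) ≤ c * (c * Fintype.card β * A) := by
  classical
  have key : ∃ c₀ : ℝ, ∀ {α β : Type} [Fintype α] [Fintype β] (a : Matrix α β (𝓞 K)) (A : ℝ),
      a ≠ 0 → 0 < Fintype.card α → Fintype.card α < Fintype.card β →
      (∀ k l, house (a k l : K) ≤ A) →
      ∃ ξ : β → 𝓞 K, ξ ≠ 0 ∧ a.mulVec ξ = 0 ∧
        ∀ l, house (ξ l : K) ≤ c₀ * (c₀ * (Fintype.card β : ℕ) * A) ^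
          (((Fintype.card α : ℕ) : ℝ) / ((Fintype.card β : ℕ) - (Fintype.card α : ℕ))) :=
    ⟨_, fun a A ha h0 h1 hA =>
      NumberField.house.exists_ne_zero_int_vec_house_le K a ha h0 h1 rfl hA rfl⟩
  obtain ⟨c₀, hc₀⟩ := key
  refine ⟨max 1 |c₀|, le_max_left _ _, fun {α β} _ _ a A ha h0 h1 hA hb => ?_⟩
  obtain ⟨ξ, hξ, h2, h3⟩ := hc₀ a A ha h0 (by omega) hb
  refine ⟨ξ, hξ, h2, fun l => (h3 l).trans ?_⟩
  set c := max 1 |c₀| with hc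
  have hc1 : 1 ≤ c := le_max_left _ _
  have hcc : |c₀| ≤ c := le_max_right _ _
  have hq : (1 : ℝ) ≤ (Fintype.card β : ℕ) := by
    have : 1 ≤ Fintype.card β := by omega
    exact_mod_cast this
  have hb1 : 1 ≤ c * Fintype.card β * A := by
    have : 1 ≤ c * Fintype.card β := by nlinarith
    nlinarith
  have hab : |c₀ * Fintype.card β * A| ≤ c * Fintype.card β * A := by
    rw [abs_mul, abs_mul, abs_of_nonneg (by linarith : (0 : ℝ) ≤ A),
      abs_of_nonneg (by linarith : (0 : ℝ) ≤ (Fintype.card β : ℕ))]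
    gcongr
  have hcast : (2 : ℝ) * (Fintype.card α : ℕ) ≤ (Fintype.card β : ℕ) := by exact_mod_cast h1
  have h0' : (1 : ℝ) ≤ (Fintype.card α : ℕ) := by exact_mod_cast h0
  have hexp : ((Fintype.card α : ℕ) : ℝ) / ((Fintype.card β : ℕ) - (Fintype.card α : ℕ)) ≤ 1 := by
    rw [div_le_one (by linarith)]; linarith
  have hexp0 : 0 ≤ ((Fintype.card α : ℕ) : ℝ) / ((Fintype.card β : ℕ) - (Fintype.card α : ℕ)) :=
    div_nonneg (by linarith) (by linarith)
  calc c₀ * (c₀ * Fintype.card β * A) ^ _ ≤ |c₀ * (c₀ * Fintype.card β * A) ^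
        (((Fintype.card α : ℕ) : ℝ) / ((Fintype.card β : ℕ) - (Fintype.card α : ℕ)))| := le_abs_self _
    _ ≤ |c₀| * |c₀ * Fintype.card β * A| ^
        (((Fintype.card α : ℕ) : ℝ) / ((Fintype.card β : ℕ) - (Fintype.card α : ℕ))) := by
      rw [abs_mul]
      gcongr
      exact Real.abs_rpow_le_abs_rpow _ _
    _ ≤ c * (c * Fintype.card β * A) ^ (1 : ℝ) := by
      gcongr
      exact (Real.rpow_le_rpow (abs_nonneg _) hab hexp0).trans
        (Real.rpow_le_rpow_of_exponent_le hb1 hexp)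
    _ = _ := by rw [Real.rpow_one]

lemma norm_pow_sub_pow_le {a b : ℂ} {E : ℝ} (hE : 1 ≤ E) (ha : ‖a‖ ≤ E) (hb : ‖b‖ ≤ E) (N : ℕ) :
    ‖a ^ N - b ^ N‖ ≤ N * E ^ N * ‖a - b‖ := by
  induction N with
  | zero => simp
  | succ N ih =>
    have e : a ^ (N + 1) - b ^ (N + 1) = a ^ N * (a - b) + (a ^ N - b ^ N) * b := by ring
    rw [e]
    calc _ ≤ ‖a‖ ^ N * ‖a - b‖ + ‖a ^ N - b ^ N‖ * ‖b‖ := by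
          refine (norm_add_le _ _).trans ?_
          rw [norm_mul, norm_mul, norm_pow]
      _ ≤ E ^ (N + 1) * ‖a - b‖ + (N * E ^ N * ‖a - b‖) * E := by
          gcongr
          exact (pow_le_pow_left₀ (norm_nonneg _) ha _).trans (pow_le_pow_right₀ hE (by omega))
      _ = _ := by push_cast; ring

/-- The first exponent attached to an index `(l₁, l₂, l)`. -/
def firstExp {S L : ℕ} (n : ℤ) (i : Fin S × Fin S × Fin L) : ℤ := (i.1 : ℤ) + i.2.2 * n

/-- The second exponent attached to an index `(l₁, l₂, l)`. -/
def secondExp {S L : ℕ} (k : ℤ) (i : Fin S × Fin S × Fin L) : ℤ := (i.2.1 : ℤ) - k * i.2.2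

/-- One coefficient in the auxiliary integers. -/
noncomputable def auxCoeff {S L : ℕ} (η p q : 𝓞 K) (n k : ℤ) (t₁ t₂ x : ℕ)
    (i : Fin S × Fin S × Fin L) : 𝓞 K :=
  (firstExp n i : 𝓞 K) ^ t₁ * (secondExp k i : 𝓞 K) ^ t₂ *
    (η ^ (i.1 : ℕ) * p ^ (i.2.2 : ℕ) * q ^ (L - i.2.2 : ℕ)) ^ x

/-- The algebraic integers replacing the values of the auxiliary function. -/
noncomputable def auxInt {S L : ℕ} (ξ : Fin S × Fin S × Fin L → 𝓞 K) (η p q : 𝓞 K) (n k : ℤ)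
    (t₁ t₂ x : ℕ) : 𝓞 K :=
  ∑ i, auxCoeff η p q n k t₁ t₂ x i * ξ i

lemma house_auxCoeff_le {S L : ℕ} {η p q : 𝓞 K} {n k : ℤ} {t₁ t₂ x : ℕ} {U E : ℝ}
    {i : Fin S × Fin S × Fin L} (hE : 1 ≤ E) (hη : house (η : K) ≤ E) (hp : house (p : K) ≤ E)
    (hq : house (q : K) ≤ E) (hu : |(firstExp n i : ℝ)| ≤ U) (hv : |(secondExp k i : ℝ)| ≤ U) :
    house (auxCoeff η p q n k t₁ t₂ x i : K) ≤ U ^ (t₁ + t₂) * E ^ ((S + L) * x) := by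
  have hU : 0 ≤ U := (abs_nonneg _).trans hu
  have hpow : ∀ {y : K} {m : ℕ} {H : ℝ}, house y ≤ H → house (y ^ m) ≤ H ^ m := fun hy =>
    (house_pow_le _ _).trans (pow_le_pow_left₀ (house_nonneg _) hy _)
  have hmul : ∀ {y z : K} {A B : ℝ}, house y ≤ A → house z ≤ B → house (y * z) ≤ A * B :=
    fun hy hz => (house_mul_le _ _).trans
      (mul_le_mul hy hz (house_nonneg _) ((house_nonneg _).trans hy))
  have h1 : house (((firstExp n i : ℤ) : K) ^ t₁) ≤ U ^ t₁ := hpow (by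
    rw [house_intCast]; exact_mod_cast hu)
  have h2 : house (((secondExp k i : ℤ) : K) ^ t₂) ≤ U ^ t₂ := hpow (by
    rw [house_intCast]; exact_mod_cast hv)
  have h3 : house (((η : K) ^ (i.1 : ℕ) * (p : K) ^ (i.2.2 : ℕ) * (q : K) ^ (L - i.2.2 : ℕ)) ^ x)
      ≤ (E ^ (i.1 : ℕ) * E ^ (i.2.2 : ℕ) * E ^ (L - i.2.2 : ℕ)) ^ x :=
    hpow (hmul (hmul (hpow hη) (hpow hp)) (hpow hq))
  have e : (auxCoeff η p q n k t₁ t₂ x i : K) = ((firstExp n i : ℤ) : K) ^ t₁ *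
      ((secondExp k i : ℤ) : K) ^ t₂ *
      ((η : K) ^ (i.1 : ℕ) * (p : K) ^ (i.2.2 : ℕ) * (q : K) ^ (L - i.2.2 : ℕ)) ^ x := by
    simp [auxCoeff]
  rw [e]
  refine (hmul (hmul h1 h2) h3).trans ?_
  rw [pow_add, pow_mul]
  gcongr
  rw [mul_assoc, ← pow_add, ← pow_add]
  have := i.2.2.isLt
  have := i.1.isLt
  exact pow_le_pow_right₀ hE (by omega)

lemma house_auxInt_le {S L : ℕ} {ξ : Fin S × Fin S × Fin L → 𝓞 K} {η p q : 𝓞 K} {n k : ℤ}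
    {t₁ t₂ x : ℕ} {U E α : ℝ} (hE : 1 ≤ E) (hη : house (η : K) ≤ E) (hp : house (p : K) ≤ E)
    (hq : house (q : K) ≤ E) (hξ : ∀ i, house (ξ i : K) ≤ α)
    (hu : ∀ i : Fin S × Fin S × Fin L, |(firstExp n i : ℝ)| ≤ U)
    (hv : ∀ i : Fin S × Fin S × Fin L, |(secondExp k i : ℝ)| ≤ U) :
    house (auxInt ξ η p q n k t₁ t₂ x : K) ≤
      (S * (S * L) : ℕ) * (U ^ (t₁ + t₂) * E ^ ((S + L) * x) * α) := by
  have e : (auxInt ξ η p q n k t₁ t₂ x : K) =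
      ∑ i, (auxCoeff η p q n k t₁ t₂ x i : K) * (ξ i : K) := by
    simp [auxInt, map_sum]
  rw [e]
  refine (house_sum_le_sum_house _ _).trans ?_
  calc _ ≤ ∑ i : Fin S × Fin S × Fin L, U ^ (t₁ + t₂) * E ^ ((S + L) * x) * α := by
        refine Finset.sum_le_sum fun i _ => (house_mul_le _ _).trans ?_
        have := house_auxCoeff_le (t₁ := t₁) (t₂ := t₂) (x := x) hE hη hp hq (hu i) (hv i)
        exact mul_le_mul this (hξ i) (house_nonneg _) ((house_nonneg _).trans this)
    _ = _ := by simp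

lemma norm_expSum_sub_auxInt_le {S L : ℕ} {ξ : Fin S × Fin S × Fin L → 𝓞 K} {η p q : 𝓞 K} {n : ℕ}
    {k : ℤ} (φ : K →+* ℂ) {θ₁ θ₂ : ℂ} (h₁ : Complex.exp θ₁ = φ η) (h₂ : Complex.exp θ₂ = 1)
    (hη : ‖φ η‖ = 1) {t₁ t₂ x : ℕ} {U E α ε : ℝ} (hE : 1 ≤ E) (hp : house (p : K) ≤ E)
    (hq : house (q : K) ≤ E) (hξ : ∀ i, house (ξ i : K) ≤ α)
    (hu : ∀ i : Fin S × Fin S × Fin L, |(firstExp n i : ℝ)| ≤ U)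
    (hv : ∀ i : Fin S × Fin S × Fin L, |(secondExp k i : ℝ)| ≤ U)
    (hε : ‖φ (q * η ^ n) - φ p‖ ≤ ε) :
    ‖φ q ^ (L * x) * expSum (fun i => φ (ξ i)) (firstExp n) (secondExp k) θ₁ θ₂ t₁ t₂ x
        - φ (auxInt ξ η p q n k t₁ t₂ x)‖ ≤
      (S * (S * L) : ℕ) * (α * U ^ (t₁ + t₂) * (((L * x : ℕ) : ℝ) * E ^ (L * x) * ε)) := by
  have e : φ (auxInt ξ η p q n k t₁ t₂ x : K) = ∑ i, φ (ξ i) * (firstExp n i : ℂ) ^ t₁ *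
      (secondExp k i : ℂ) ^ t₂ *
      (φ η ^ (i.1 : ℕ) * φ p ^ (i.2.2 : ℕ) * φ q ^ (L - i.2.2 : ℕ)) ^ x := by
    simp only [auxInt, auxCoeff, map_sum, map_mul, map_pow, map_intCast]
    exact Finset.sum_congr rfl fun i _ => by ring
  have hexp : ∀ i : Fin S × Fin S × Fin L,
      Complex.exp ((firstExp n i * θ₁ + secondExp k i * θ₂) * x) =
        (φ η ^ (i.1 : ℕ) * (φ η ^ n) ^ (i.2.2 : ℕ)) ^ x := by
    intro i
    have : ((firstExp n i * θ₁ + secondExp k i * θ₂) * x : ℂ) =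
        (x : ℂ) * ((firstExp n i : ℤ) * θ₁ + (secondExp k i : ℤ) * θ₂) := by ring
    rw [this, Complex.exp_nat_mul, Complex.exp_add, Complex.exp_int_mul, Complex.exp_int_mul,
      h₁, h₂, one_zpow, mul_one]
    congr 1
    have e2 : firstExp (n : ℤ) i = (((i.1 : ℕ) + n * (i.2.2 : ℕ) : ℕ) : ℤ) := by
      simp [firstExp]; ring
    rw [e2, zpow_natCast, pow_add, pow_mul]
  have hφp : ‖φ p‖ ≤ E := (norm_embedding_le_house _ φ).trans hp
  have hφq : ‖φ q‖ ≤ E := (norm_embedding_le_house _ φ).trans hq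
  rw [e, expSum, Finset.mul_sum, ← Finset.sum_sub_distrib]
  calc _ ≤ ∑ i : Fin S × Fin S × Fin L,
        α * U ^ (t₁ + t₂) * (((L * x : ℕ) : ℝ) * E ^ (L * x) * ε) := by
        refine norm_sum_le_of_le _ fun i _ => ?_
        have hl := i.2.2.isLt
        have hU : 0 ≤ U := (abs_nonneg _).trans (hu i)
        have hα : 0 ≤ α := (house_nonneg _).trans (hξ i)
        have e3 : φ q ^ (L * x) * (φ (ξ i) * (firstExp n i : ℂ) ^ t₁ * (secondExp k i : ℂ) ^ t₂ *
            Complex.exp ((firstExp n i * θ₁ + secondExp k i * θ₂) * x)) -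
            φ (ξ i) * (firstExp n i : ℂ) ^ t₁ * (secondExp k i : ℂ) ^ t₂ *
            (φ η ^ (i.1 : ℕ) * φ p ^ (i.2.2 : ℕ) * φ q ^ (L - i.2.2 : ℕ)) ^ x =
            φ (ξ i) * ((firstExp n i : ℂ) ^ t₁ * (secondExp k i : ℂ) ^ t₂) *
            ((φ η ^ (i.1 : ℕ)) ^ x * φ q ^ ((L - i.2.2 : ℕ) * x) *
            ((φ (q * η ^ n)) ^ ((i.2.2 : ℕ) * x) - φ p ^ ((i.2.2 : ℕ) * x))) := by
          have : L * x = (L - i.2.2 : ℕ) * x + (i.2.2 : ℕ) * x := by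
            rw [← add_mul]; congr 1; omega
          rw [hexp, this, map_mul, map_pow, pow_add]
          ring
        rw [e3, norm_mul, norm_mul, norm_mul, norm_pow, norm_pow, Complex.norm_intCast,
          Complex.norm_intCast, pow_add]
        have h4 : ‖(φ η ^ (i.1 : ℕ)) ^ x * φ q ^ ((L - i.2.2 : ℕ) * x) *
            ((φ (q * η ^ n)) ^ ((i.2.2 : ℕ) * x) - φ p ^ ((i.2.2 : ℕ) * x))‖ ≤
            ((L * x : ℕ) : ℝ) * E ^ (L * x) * ε := by
          rw [norm_mul, norm_mul, norm_pow, norm_pow, hη, one_pow, one_pow, one_mul, norm_pow]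
          have h5 : ‖φ (q * η ^ n)‖ ≤ E := by
            rw [map_mul, map_pow, norm_mul, norm_pow, hη, one_pow, mul_one]; exact hφq
          calc _ ≤ E ^ ((L - i.2.2 : ℕ) * x) * ((((i.2.2 : ℕ) * x : ℕ) : ℝ) *
                E ^ ((i.2.2 : ℕ) * x) * ε) := by
                gcongr
                refine (norm_pow_sub_pow_le hE h5 hφp _).trans ?_
                gcongr
            _ = (((i.2.2 : ℕ) * x : ℕ) : ℝ) * E ^ (L * x) * ε := by
                have : L * x = (L - i.2.2 : ℕ) * x + (i.2.2 : ℕ) * x := by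
                  rw [← add_mul]; congr 1; omega
                rw [this, pow_add]; ring
            _ ≤ _ := by
                have : 0 ≤ ε := (norm_nonneg _).trans hε
                gcongr
        gcongr
        · exact (norm_embedding_le_house _ φ).trans (hξ i)
        · exact hu i
        · exact hv i
    _ = _ := by simp

end Arithmetic

section Extrapolation

variable {K : Type*} [Field K] [NumberField K]

set_option maxHeartbeats 2000000 in
/-- One extrapolation step for the auxiliary integers. -/
lemma auxInt_extrapolate {P Y M : ℕ} (hP : 1000 ≤ P) (hD : 10 * Module.finrank ℚ K ≤ P)
    (hY : P ^ 3 ≤ Y) (hY' : Y ≤ P ^ 59) (hM : P ^ 53 ≤ M) (hM' : M ≤ 16 * P ^ 53)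
    {ξ : Fin (P ^ 37) × Fin (P ^ 37) × Fin (P ^ 36) → 𝓞 K} {η p q : 𝓞 K} {n : ℕ}
    {k : ℤ} (φ : K →+* ℂ) {θ₁ θ₂ : ℂ} (h₁ : Complex.exp θ₁ = φ η) (h₂ : Complex.exp θ₂ = 1)
    (hθ : 1 ≤ ‖θ₁‖ + ‖θ₂‖) (hθ' : ‖θ₁‖ + ‖θ₂‖ ≤ 10) (hφη : ‖φ η‖ = 1) (hq0 : q ≠ 0)
    (hη : house (η : K) ≤ Real.exp P)
    (hp : house (p : K) ≤ Real.exp P)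
    (hq : house (q : K) ≤ Real.exp P) (hξ : ∀ i, house (ξ i : K) ≤ Real.exp (130 * P ^ 54))
    (hu : ∀ i : Fin (P ^ 37) × Fin (P ^ 37) × Fin (P ^ 36),
      |(firstExp n i : ℝ)| ≤ Real.exp (2 * P))
    (hv : ∀ i : Fin (P ^ 37) × Fin (P ^ 37) × Fin (P ^ 36),
      |(secondExp k i : ℝ)| ≤ Real.exp (2 * P))
    (hw : ∀ i : Fin (P ^ 37) × Fin (P ^ 37) × Fin (P ^ 36),
      ‖firstExp n i * θ₁ + secondExp k i * θ₂‖ ≤ 13 * P ^ 37)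
    (hε : ‖φ (q * η ^ n) - φ p‖ ≤ Real.exp (-(P : ℝ) ^ 200))
    (h0 : ∀ x < Y, ∀ t₁ < 2 * M, ∀ t₂ < 2 * M, auxInt ξ η p q n k t₁ t₂ x = 0)
    {x t₁ t₂ : ℕ} (hx : x < P ^ 14 * Y) (ht₁ : t₁ < M) (ht₂ : t₂ < M) :
    auxInt ξ η p q n k t₁ t₂ x = 0 := by
  by_contra hne
  have hPr : (1000 : ℝ) ≤ P := by exact_mod_cast hP
  have hP0 : (0 : ℝ) ≤ P := by linarith
  have hYr : (P : ℝ) ^ 3 ≤ Y := by exact_mod_cast hY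
  have hYr' : (Y : ℝ) ≤ P ^ 59 := by exact_mod_cast hY'
  have hMr : (P : ℝ) ^ 53 ≤ M := by exact_mod_cast hM
  have hMr' : (M : ℝ) ≤ 16 * P ^ 53 := by exact_mod_cast hM'
  have hDr : (10 : ℝ) * Module.finrank ℚ K ≤ P := by exact_mod_cast hD
  have hPe : (P : ℝ) ≤ Real.exp P := by linarith [Real.add_one_le_exp (P : ℝ)]
  have hmono : ∀ a b : ℕ, a < b → 1000 * (P : ℝ) ^ a ≤ (P : ℝ) ^ b := by
    intro a b hab
    calc 1000 * (P : ℝ) ^ a ≤ P * P ^ a := by gcongr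
      _ = P ^ (a + 1) := by ring
      _ ≤ P ^ b := pow_le_pow_right₀ (by linarith) (by omega)
  have hpos : ∀ a : ℕ, 1 ≤ (P : ℝ) ^ a := fun a => one_le_pow₀ (by linarith)
  have hcard : ((P ^ 37 * (P ^ 37 * P ^ 36) : ℕ) : ℝ) ≤ Real.exp (110 * P) := by
    have : ((P ^ 37 * (P ^ 37 * P ^ 36) : ℕ) : ℝ) = (P : ℝ) ^ 110 := by push_cast; ring
    rw [this, show (110 : ℝ) * P = ((110 : ℕ) : ℝ) * P by norm_num, Real.exp_nat_mul]
    gcongr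
  have hUM : ∀ N ≤ 4 * M, Real.exp (2 * P) ^ N ≤ Real.exp (128 * P ^ 54) := by
    intro N hN
    rw [← Real.exp_nat_mul, Real.exp_le_exp]
    have : (N : ℝ) ≤ 4 * M := by exact_mod_cast hN
    calc (N : ℝ) * (2 * P) ≤ (4 * (16 * P ^ 53)) * (2 * P) := by gcongr; linarith
      _ = 128 * P ^ 54 := by ring
  -- comparison of the function with the integers
  have hcmp : ∀ x' s₁ s₂ : ℕ, x' ≤ P ^ 73 → s₁ < 2 * M → s₂ < 2 * M →
      ‖φ q ^ (P ^ 36 * x') * expSum (fun i => φ (ξ i)) (firstExp n) (secondExp k) θ₁ θ₂ s₁ s₂ x'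
        - φ (auxInt ξ η p q n k s₁ s₂ x')‖ ≤ Real.exp (-(P : ℝ) ^ 199) := by
    intro x' s₁ s₂ hx' hs₁ hs₂
    have h := norm_expSum_sub_auxInt_le (t₁ := s₁) (t₂ := s₂) (x := x') φ h₁ h₂ hφη
      (Real.one_le_exp hP0) hp hq hξ hu hv hε
    refine h.trans ?_
    have hx'' : (x' : ℝ) ≤ P ^ 73 := by exact_mod_cast hx'
    have hLx : ((P ^ 36 * x' : ℕ) : ℝ) ≤ P ^ 109 := by
      push_cast
      calc (P : ℝ) ^ 36 * x' ≤ P ^ 36 * P ^ 73 := by gcongr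
        _ = (P : ℝ) ^ 109 := by ring
    have hLe : ((P ^ 36 * x' : ℕ) : ℝ) ≤ Real.exp (P ^ 109) := by
      linarith [Real.add_one_le_exp ((P : ℝ) ^ 109)]
    have hEL : Real.exp P ^ (P ^ 36 * x') ≤ Real.exp (P ^ 110) := by
      rw [← Real.exp_nat_mul, Real.exp_le_exp]
      calc _ ≤ (P : ℝ) ^ 109 * P := by gcongr
        _ = P ^ 110 := by ring
    calc _ ≤ Real.exp (110 * P) * (Real.exp (130 * P ^ 54) * Real.exp (128 * P ^ 54) *
          (Real.exp (P ^ 109) * Real.exp (P ^ 110) * Real.exp (-(P : ℝ) ^ 200))) := by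
          gcongr
          exact hUM _ (by omega)
      _ ≤ _ := by
          simp only [← Real.exp_add]
          rw [Real.exp_le_exp]
          have := hmono 1 110 (by norm_num)
          have := hmono 54 110 (by norm_num)
          have := hmono 109 110 (by norm_num)
          have := hmono 110 199 (by norm_num)
          have := hmono 199 200 (by norm_num)
          have := hpos 110
          have := hpos 199
          linarith
  obtain ⟨Q, hQ⟩ : ∃ Q : ℝ, Q = P ^ 52 * Y := ⟨_, rfl⟩
  have hQ54 : 1000 * (P : ℝ) ^ 54 ≤ Q := by
    calc 1000 * (P : ℝ) ^ 54 ≤ P ^ 55 := hmono _ _ (by norm_num)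
      _ = P ^ 52 * P ^ 3 := by ring
      _ ≤ Q := by rw [hQ]; gcongr
  have hQ111 : Q ≤ P ^ 111 := by
    calc Q ≤ P ^ 52 * P ^ 59 := by rw [hQ]; gcongr
      _ = P ^ 111 := by ring
  have hQ1 : 1000 * (P : ℝ) ≤ Q := by
    have := hmono 1 54 (by norm_num)
    have := hpos 54
    linarith
  have hxY : (x : ℝ) ≤ P ^ 14 * Y := by exact_mod_cast hx.le
  have hQ0 : 0 ≤ Q := by linarith
  have hPQ : 1000 * Q ≤ P * Q := mul_le_mul_of_nonneg_right hPr hQ0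
  -- smallness at the known points
  set δ := Real.exp (-(P : ℝ) ^ 198) with hδ
  have hsmall : ∀ x' < Y, ∀ s₁ < 2 * M, ∀ s₂ < 2 * M,
      ‖expSum (fun i => φ (ξ i)) (firstExp n) (secondExp k) θ₁ θ₂ s₁ s₂ x'‖ ≤ δ := by
    intro x' hx' s₁ hs₁ s₂ hs₂
    have hx73 : x' ≤ P ^ 73 := by
      have : P ^ 59 ≤ P ^ 73 := Nat.pow_le_pow_right (by omega) (by norm_num)
      omega
    have h := hcmp x' s₁ s₂ hx73 hs₁ hs₂
    rw [h0 x' hx' s₁ hs₁ s₂ hs₂] at h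
    simp only [map_zero, sub_zero, norm_mul, norm_pow] at h
    have hl := one_le_norm_mul_pow_of_house_le hq0 φ hq
    set N := P ^ 36 * x' with hN
    have hNr : (N : ℝ) ≤ P ^ 109 := by
      have : (x' : ℝ) ≤ P ^ 73 := by exact_mod_cast hx73
      rw [hN]; push_cast
      calc (P : ℝ) ^ 36 * x' ≤ P ^ 36 * P ^ 73 := by gcongr
        _ = (P : ℝ) ^ 109 := by ring
    have hl' : 1 ≤ ‖φ q‖ ^ N * Real.exp (P ^ 111) := by
      calc (1 : ℝ) ≤ (‖φ q‖ * Real.exp P ^ Module.finrank ℚ K) ^ N := one_le_pow₀ hl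
        _ = ‖φ q‖ ^ N * Real.exp (N * (Module.finrank ℚ K * P)) := by
          rw [mul_pow, ← Real.exp_nat_mul, ← Real.exp_nat_mul]
        _ ≤ _ := by
          gcongr
          calc (N : ℝ) * (Module.finrank ℚ K * P) ≤ P ^ 109 * (P * P) := by
                gcongr; linarith
            _ = P ^ 111 := by ring
    set G := ‖expSum (fun i => φ (ξ i)) (firstExp n) (secondExp k) θ₁ θ₂ s₁ s₂ x'‖
    calc G = 1 * G := (one_mul _).symm
      _ ≤ (‖φ q‖ ^ N * Real.exp (P ^ 111)) * G := by gcongr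
      _ = Real.exp (P ^ 111) * (‖φ q‖ ^ N * G) := by ring
      _ ≤ Real.exp (P ^ 111) * Real.exp (-(P : ℝ) ^ 199) := by gcongr
      _ ≤ δ := by
        rw [← Real.exp_add, hδ, Real.exp_le_exp]
        have := hmono 111 198 (by norm_num)
        have := hmono 198 199 (by norm_num)
        have := hpos 198
        linarith
  have hr1 : (1 : ℝ) ≤ P ^ 14 * Y := by
    have := hpos 14
    have := hpos 3
    nlinarith
  have hYrr : (Y : ℝ) ≤ P ^ 14 * Y := by
    have := hpos 14
    nlinarith
  have hsch := norm_expSum_le_of_almost_vanishing (u := firstExp (n : ℤ)) (v := secondExp k)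
    (a := fun i => φ (ξ i)) (z := (x : ℂ)) hsmall (by positivity)
    hr1 hYrr (fun i => (norm_embedding_le_house _ φ).trans (hξ i)) hu hv
    (Real.one_le_exp (by linarith)) hw (by positivity) (by positivity) hθ ht₁ ht₂
    (by rw [Complex.norm_natCast]; exact hxY)
  set F := ‖expSum (fun i => φ (ξ i)) (firstExp n) (secondExp k) θ₁ θ₂ t₁ t₂ x‖
  set E := (‖θ₁‖ + ‖θ₂‖) ^ M * δ * (14 * ((P : ℝ) ^ 14 * Y)) ^ (Y * M ^ 2 + 3 * M + 2) with hE
  have hEb : E ≤ Real.exp (-(P * Q)) := by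
    have e1 : (‖θ₁‖ + ‖θ₂‖) ^ M ≤ Real.exp (P ^ 60) := by
      calc (‖θ₁‖ + ‖θ₂‖) ^ M ≤ (Real.exp P) ^ M := by gcongr; linarith
        _ = Real.exp (M * P) := by rw [← Real.exp_nat_mul]
        _ ≤ _ := by
          rw [Real.exp_le_exp]
          calc (M : ℝ) * P ≤ (16 * P ^ 53) * P := by gcongr
            _ = 16 * P ^ 54 := by ring
            _ ≤ P ^ 60 := by
              have := hmono 54 60 (by norm_num)
              have := hpos 54
              linarith
    have e2 : (14 * ((P : ℝ) ^ 14 * Y)) ^ (Y * M ^ 2 + 3 * M + 2) ≤ Real.exp (P ^ 180) := by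
      have e3 : 14 * ((P : ℝ) ^ 14 * Y) ≤ Real.exp (74 * P) := by
        calc 14 * ((P : ℝ) ^ 14 * Y) ≤ P * (P ^ 14 * P ^ 59) := by gcongr; linarith
          _ = (P : ℝ) ^ 74 := by ring
          _ ≤ Real.exp P ^ 74 := by gcongr
          _ = _ := by rw [← Real.exp_nat_mul]; norm_num
      calc _ ≤ Real.exp (74 * P) ^ (Y * M ^ 2 + 3 * M + 2) := by gcongr
        _ = Real.exp (((Y * M ^ 2 + 3 * M + 2 : ℕ) : ℝ) * (74 * P)) := by rw [← Real.exp_nat_mul]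
        _ ≤ _ := by
          rw [Real.exp_le_exp]
          push_cast
          have hM1 := hpos 53
          calc ((Y : ℝ) * M ^ 2 + 3 * M + 2) * (74 * P)
              ≤ ((P : ℝ) ^ 59 * (16 * P ^ 53) ^ 2 + 3 * (16 * P ^ 53) + 2) * (74 * P) := by gcongr
            _ ≤ ((P : ℝ) ^ 170) * P ^ 10 := by
              gcongr
              · have := hmono 165 170 (by norm_num)
                have := hmono 53 165 (by norm_num)
                have := hpos 53
                have : (P : ℝ) ^ 59 * (16 * P ^ 53) ^ 2 = 256 * P ^ 165 := by ring
                linarith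
              · have := hmono 1 10 (by norm_num)
                linarith
            _ = _ := by ring
    calc E ≤ Real.exp (P ^ 60) * Real.exp (-(P : ℝ) ^ 198) * Real.exp (P ^ 180) := by
          rw [hE, hδ]; gcongr
      _ ≤ _ := by
        simp only [← Real.exp_add]
        rw [Real.exp_le_exp]
        have := hmono 60 180 (by norm_num)
        have := hmono 112 180 (by norm_num)
        have := hmono 180 198 (by norm_num)
        have := hpos 180
        have : P * Q ≤ (P : ℝ) ^ 112 := by
          calc P * Q ≤ P * P ^ 111 := by gcongr
            _ = P ^ 112 := by ring
        linarith
  have hB : (Fintype.card (Fin (P ^ 37) × Fin (P ^ 37) × Fin (P ^ 36)) : ℝ) *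
      (Real.exp (130 * P ^ 54) * Real.exp (2 * P) ^ (2 * M) *
        Real.exp (13 * P ^ 37 * (7 * (P ^ 14 * Y)))) ≤ Real.exp (2 * Q) := by
    simp only [Fintype.card_prod, Fintype.card_fin]
    calc _ ≤ Real.exp (110 * P) * (Real.exp (130 * P ^ 54) * Real.exp (128 * P ^ 54) *
        Real.exp (13 * P ^ 37 * (7 * (P ^ 14 * Y)))) := by
          gcongr
          exact hUM _ (by omega)
      _ ≤ _ := by
        simp only [← Real.exp_add]
        rw [Real.exp_le_exp]
        have : 13 * (P : ℝ) ^ 37 * (7 * (P ^ 14 * Y)) ≤ P ^ 52 * Y / 10 := by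
          have h : 1000 * ((P : ℝ) ^ 51 * Y) ≤ P ^ 52 * Y := by
            rw [← mul_assoc]
            gcongr
            exact hmono _ _ (by norm_num)
          have : 0 ≤ (P : ℝ) ^ 51 * Y :=
            mul_nonneg (pow_nonneg hP0 _) (Nat.cast_nonneg _)
          linarith
        linarith
  have hgain : ((1 : ℝ) / 3) ^ (Y * M) ≤ Real.exp (-(P * Q)) := by
    have e1 : ((1 : ℝ) / 3) ≤ Real.exp (-1) := by
      rw [Real.exp_neg, one_div]
      gcongr
      linarith [Real.exp_one_lt_d9]
    calc ((1 : ℝ) / 3) ^ (Y * M) ≤ Real.exp (-1) ^ (Y * M) := by gcongr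
      _ = Real.exp (-((Y * M : ℕ) : ℝ)) := by rw [← Real.exp_nat_mul]; ring_nf
      _ ≤ _ := by
        rw [Real.exp_le_exp, neg_le_neg_iff]
        push_cast
        calc P * Q = Y * P ^ 53 := by rw [hQ]; ring
          _ ≤ _ := by gcongr
  have hE0 : 0 ≤ E := by positivity
  have hE1 : E ≤ Real.exp (2 * Q) := hEb.trans (by
    rw [Real.exp_le_exp]; nlinarith)
  have hF : F ≤ 3 * Real.exp (2 * Q - P * Q) := by
    have e1 : Real.exp (2 * Q - P * Q) = Real.exp (2 * Q) * Real.exp (-(P * Q)) := by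
      rw [← Real.exp_add]; ring_nf
    have e2 : 1 ≤ Real.exp (2 * Q) := Real.one_le_exp (by linarith)
    calc F ≤ (Real.exp (2 * Q) + Real.exp (2 * Q)) * Real.exp (-(P * Q))
          + 1 * Real.exp (-(P * Q)) := by
          refine hsch.trans ?_
          gcongr
          rw [one_mul]; exact hEb
      _ ≤ (Real.exp (2 * Q) + Real.exp (2 * Q)) * Real.exp (-(P * Q))
          + Real.exp (2 * Q) * Real.exp (-(P * Q)) := by gcongr
      _ = _ := by rw [e1]; ring
  have hx73 : x ≤ P ^ 73 := by
    have : P ^ 14 * Y ≤ P ^ 14 * P ^ 59 := by gcongr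
    exact hx.le.trans (this.trans_eq (by ring))
  have hA : ‖φ (auxInt ξ η p q n k t₁ t₂ x)‖ ≤ 4 * Real.exp (3 * Q - P * Q) := by
    have h := hcmp x t₁ t₂ hx73 (by omega) (by omega)
    have e1 : ‖φ q‖ ^ (P ^ 36 * x) ≤ Real.exp Q := by
      calc ‖φ q‖ ^ (P ^ 36 * x) ≤ Real.exp P ^ (P ^ 36 * x) := by
            gcongr; exact (norm_embedding_le_house _ φ).trans hq
        _ = Real.exp ((P ^ 36 * x : ℕ) * P) := by rw [← Real.exp_nat_mul]
        _ ≤ _ := by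
          rw [Real.exp_le_exp, hQ]
          push_cast
          calc (P : ℝ) ^ 36 * x * P ≤ (P : ℝ) ^ 36 * (P ^ 14 * Y) * P := by gcongr
            _ = (P : ℝ) ^ 51 * Y := by ring
            _ ≤ (P : ℝ) ^ 52 * Y := by
              gcongr
              · linarith
              · norm_num
    have e2 : Real.exp (-(P : ℝ) ^ 199) ≤ Real.exp (3 * Q - P * Q) := by
      rw [Real.exp_le_exp]
      have : P * Q ≤ (P : ℝ) ^ 112 := by
        calc P * Q ≤ P * P ^ 111 := by gcongr
          _ = P ^ 112 := by ring
      have := hmono 112 199 (by norm_num)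
      have := hpos 112
      linarith
    have e3 := norm_sub_norm_le (φ (auxInt ξ η p q n k t₁ t₂ x))
      (φ q ^ (P ^ 36 * x) * expSum (fun i => φ (ξ i)) (firstExp n) (secondExp k) θ₁ θ₂ t₁ t₂ x)
    rw [norm_sub_rev, norm_mul, norm_pow] at e3
    have e4 : ‖φ q‖ ^ (P ^ 36 * x) * F ≤ Real.exp Q * (3 * Real.exp (2 * Q - P * Q)) := by gcongr
    have e5 : Real.exp Q * (3 * Real.exp (2 * Q - P * Q)) = 3 * Real.exp (3 * Q - P * Q) := by
      rw [mul_left_comm, ← Real.exp_add]; ring_nf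
    linarith
  have hH : house (auxInt ξ η p q n k t₁ t₂ x : K) ≤ Real.exp (3 * Q) := by
    refine (house_auxInt_le (Real.one_le_exp hP0) hη hp hq hξ hu hv).trans ?_
    have e1 : Real.exp P ^ ((P ^ 37 + P ^ 36) * x) ≤ Real.exp (2 * Q) := by
      rw [← Real.exp_nat_mul, Real.exp_le_exp, hQ]
      push_cast
      calc ((P : ℝ) ^ 37 + P ^ 36) * x * P ≤ ((P : ℝ) ^ 37 + P ^ 37) * (P ^ 14 * Y) * P := by
            gcongr
            · linarith
            · norm_num
        _ = 2 * ((P : ℝ) ^ 52 * Y) := by ring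
    calc _ ≤ Real.exp (110 * P) * (Real.exp (128 * P ^ 54) * Real.exp (2 * Q) *
          Real.exp (130 * P ^ 54)) := by
          gcongr
          exact hUM _ (by omega)
      _ ≤ _ := by
        simp only [← Real.exp_add]
        rw [Real.exp_le_exp]
        linarith
  have hfin := one_le_norm_mul_pow_of_house_le hne φ hH
  have h4 : (4 : ℝ) ≤ Real.exp Q := by linarith [Real.add_one_le_exp Q]
  have : ‖φ (auxInt ξ η p q n k t₁ t₂ x)‖ * Real.exp (3 * Q) ^ Module.finrank ℚ K < 1 := by
    calc _ ≤ (Real.exp Q * Real.exp (3 * Q - P * Q)) *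
          Real.exp (3 * Q) ^ Module.finrank ℚ K := by
          gcongr
          exact hA.trans (by gcongr)
      _ = Real.exp (4 * Q - P * Q + 3 * Module.finrank ℚ K * Q) := by
          rw [← Real.exp_nat_mul, ← Real.exp_add, ← Real.exp_add]
          ring_nf
      _ < 1 := by
          rw [Real.exp_lt_one_iff]
          have : (10 * Module.finrank ℚ K) * Q ≤ P * Q := mul_le_mul_of_nonneg_right hDr hQ0
          nlinarith
  linarith

end Extrapolation

section Baker

variable {K : Type*} [Field K] [NumberField K]

lemma eq_zero_of_auxInt_eq_zero {S L T X : ℕ} {ξ : Fin S × Fin S × Fin L → 𝓞 K} {η p q : 𝓞 K}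
    {n : ℕ} {k : ℤ} (hη : ∀ m : ℕ, 0 < m → η ^ m ≠ 1) (hη0 : η ≠ 0) (hp : p ≠ 0) (hq : q ≠ 0)
    (hn : S ≤ n) (hTS : S ≤ T) (hTL : L ≤ T) (hX : S * L ≤ X)
    (h : ∀ x < X, ∀ t₁ < T, ∀ t₂ < T, auxInt ξ η p q n k t₁ t₂ x = 0) : ξ = 0 := by
  have hp' : (p : K) ≠ 0 := by simpa using hp
  have hq' : (q : K) ≠ 0 := by simpa using hq
  have hη0' : (η : K) ≠ 0 := by simpa using hη0
  have key := eq_zero_of_exponential_sums (fun i => (ξ i : K)) (η := (η : K))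
    (γ := (p : K) / q) (n := n) (k := k) (T := T) (X := X) (fun m hm e => hη m hm (by
      apply RingOfIntegers.ext
      simpa using e)) hη0' (div_ne_zero hp' hq') (by exact_mod_cast hn) hTS hTL hX ?_
  · funext i
    have := congrFun key i
    simpa using this
  · intro t₁ ht₁ t₂ ht₂ x hx
    have h1 := congrArg (fun y : 𝓞 K => (y : K)) (h x hx t₁ ht₁ t₂ ht₂)
    simp only [auxInt, auxCoeff, map_sum, map_mul, map_pow, map_intCast, map_zero] at h1
    refine (mul_eq_zero.1 (?_ : (q : K) ^ (L * x) * _ = 0)).resolve_left (pow_ne_zero _ hq')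
    rw [← h1, Finset.mul_sum]
    refine Finset.sum_congr rfl fun i _ => ?_
    have hl := i.2.2.isLt
    have e : (q : K) ^ (L * x) = ((q : K) ^ (L - i.2.2 : ℕ)) ^ x * ((q : K) ^ (i.2.2 : ℕ)) ^ x := by
      rw [← mul_pow, ← pow_add, ← pow_mul]; congr 2; omega
    rw [e, div_pow]
    simp only [firstExp, secondExp, mul_pow, div_pow]
    have : ((q : K) ^ (i.2.2 : ℕ)) ^ x ≠ 0 := pow_ne_zero _ (pow_ne_zero _ hq')
    field_simp

lemma two_mul_pow_le_exp {P : ℝ} (hP : 20000 ≤ P) : 2 * P ^ 37 ≤ Real.exp P := by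
  have h1 : P / 74 ≤ Real.exp (P / 74) := by linarith [Real.add_one_le_exp (P / 74)]
  calc 2 * P ^ 37 ≤ 2 ^ 37 * P ^ 37 := by gcongr; norm_num
    _ = (2 * P) ^ 37 := by ring
    _ ≤ ((P / 74) ^ 2) ^ 37 := by
      gcongr
      nlinarith
    _ ≤ ((Real.exp (P / 74)) ^ 2) ^ 37 := by gcongr
    _ = Real.exp P := by
      rw [← pow_mul, ← Real.exp_nat_mul]
      congr 1
      push_cast
      ring

/-- The case of small exponents of the lower bound, from Liouville's inequality. -/
lemma liouville_lower_bound {P : ℕ} (hP : 1000 ≤ P) (hD : 10 * Module.finrank ℚ K ≤ P)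
    {η p q : 𝓞 K} {n : ℕ} (φ : K →+* ℂ) (hη : house (η : K) ≤ Real.exp P)
    (hp : house (p : K) ≤ Real.exp P) (hq : house (q : K) ≤ Real.exp P) (hn : n < P ^ 37)
    (hne : q * η ^ n ≠ p) : Real.exp (-(P : ℝ) ^ 200) ≤ ‖φ (q * η ^ n) - φ p‖ := by
  have hPr : (1000 : ℝ) ≤ P := by exact_mod_cast hP
  have hP0 : (0 : ℝ) ≤ P := by linarith
  have hDr : (10 : ℝ) * Module.finrank ℚ K ≤ P := by exact_mod_cast hD
  have hmono : ∀ a b : ℕ, a < b → 1000 * (P : ℝ) ^ a ≤ (P : ℝ) ^ b := by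
    intro a b hab
    calc 1000 * (P : ℝ) ^ a ≤ P * P ^ a := by gcongr
      _ = P ^ (a + 1) := by ring
      _ ≤ P ^ b := pow_le_pow_right₀ (by linarith) (by omega)
  have hpos : ∀ a : ℕ, 1 ≤ (P : ℝ) ^ a := fun a => one_le_pow₀ (by linarith)
  have hH : house ((q * η ^ n - p : 𝓞 K) : K) ≤ Real.exp (P ^ 40) := by
    have e1 : house ((q : K) * (η : K) ^ n) ≤ Real.exp P * Real.exp P ^ n :=
      (house_mul_le _ _).trans (mul_le_mul hq ((house_pow_le _ _).trans
        (pow_le_pow_left₀ (house_nonneg _) hη _)) (house_nonneg _) (by positivity))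
    have e2 : house ((q * η ^ n - p : 𝓞 K) : K) ≤
        house ((q : K) * (η : K) ^ n) + house (p : K) := by
      have : ((q * η ^ n - p : 𝓞 K) : K) = (q : K) * (η : K) ^ n - (p : K) := by simp
      rw [this]
      simp only [house, map_sub]
      exact norm_sub_le _ _
    have e3 : Real.exp P * Real.exp P ^ n ≤ Real.exp (P ^ 39) := by
      rw [← Real.exp_nat_mul, ← Real.exp_add, Real.exp_le_exp]
      have : (n : ℝ) ≤ P ^ 37 := by exact_mod_cast hn.le
      have h1 : (n : ℝ) * P ≤ P ^ 38 := by
        calc (n : ℝ) * P ≤ P ^ 37 * P := by gcongr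
          _ = P ^ 38 := by ring
      have := hmono 1 38 (by norm_num)
      have := hmono 38 39 (by norm_num)
      have := hpos 38
      linarith
    have e4 : Real.exp P ≤ Real.exp (P ^ 39) := by
      rw [Real.exp_le_exp]
      have := hmono 1 39 (by norm_num)
      linarith
    have e5 : 2 * Real.exp (P ^ 39) ≤ Real.exp (P ^ 40) := by
      have : (2 : ℝ) ≤ Real.exp (P ^ 39) := by
        linarith [Real.add_one_le_exp ((P : ℝ) ^ 39), hpos 39]
      calc 2 * Real.exp (P ^ 39) ≤ Real.exp (P ^ 39) * Real.exp (P ^ 39) := by gcongr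
        _ ≤ _ := by
          rw [← Real.exp_add, Real.exp_le_exp]
          have := hmono 39 40 (by norm_num)
          have := hpos 39
          linarith
    linarith
  have h := one_le_norm_mul_pow_of_house_le (sub_ne_zero.2 hne) φ hH
  have e6 : φ ((q * η ^ n - p : 𝓞 K) : K) = φ (q * η ^ n) - φ p := by simp
  rw [e6, ← Real.exp_nat_mul] at h
  have h2 : Real.exp (Module.finrank ℚ K * P ^ 40) ≤ Real.exp (P ^ 200) := by
    rw [Real.exp_le_exp]
    calc (Module.finrank ℚ K : ℝ) * P ^ 40 ≤ P * P ^ 40 := by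
          gcongr
          have : (0 : ℝ) ≤ Module.finrank ℚ K := Nat.cast_nonneg _
          linarith
      _ = (P : ℝ) ^ 41 := by ring
      _ ≤ (P : ℝ) ^ 200 := pow_le_pow_right₀ (by linarith) (by norm_num)
  rw [Real.exp_neg, inv_le_iff_one_le_mul₀ (by positivity)]
  refine h.trans ?_
  gcongr

/-- Existence of the auxiliary function. -/
lemma exists_auxInt_vanishing (K : Type*) [Field K] [NumberField K] : ∃ P₀ : ℕ, ∀ P ≥ P₀,
    ∀ (η p q : 𝓞 K) (n k : ℤ), house (η : K) ≤ Real.exp P → house (p : K) ≤ Real.exp P →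
    house (q : K) ≤ Real.exp P →
    (∀ i : Fin (P ^ 37) × Fin (P ^ 37) × Fin (P ^ 36), |(firstExp n i : ℝ)| ≤ Real.exp (2 * P)) →
    (∀ i : Fin (P ^ 37) × Fin (P ^ 37) × Fin (P ^ 36), |(secondExp k i : ℝ)| ≤ Real.exp (2 * P)) →
    ∃ ξ : Fin (P ^ 37) × Fin (P ^ 37) × Fin (P ^ 36) → 𝓞 K, ξ ≠ 0 ∧
      (∀ i, house (ξ i : K) ≤ Real.exp (130 * P ^ 54)) ∧
      ∀ x < P ^ 3, ∀ t₁ < 32 * P ^ 53, ∀ t₂ < 32 * P ^ 53, auxInt ξ η p q n k t₁ t₂ x = 0 := by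
  obtain ⟨c, hc1, hc⟩ := exists_siegel_const K
  refine ⟨max 20000 ⌈c⌉₊, fun P hP η p q n k hη hp hq hu hv => ?_⟩
  have hP1 : 20000 ≤ P := le_trans (le_max_left _ _) hP
  have hPc : c ≤ P := (Nat.le_ceil c).trans (by exact_mod_cast le_trans (le_max_right _ _) hP)
  have hPr : (20000 : ℝ) ≤ P := by exact_mod_cast hP1
  have hP0 : (0 : ℝ) ≤ P := by linarith
  have hmono : ∀ a b : ℕ, a < b → 1000 * (P : ℝ) ^ a ≤ (P : ℝ) ^ b := by
    intro a b hab
    calc 1000 * (P : ℝ) ^ a ≤ P * P ^ a := by gcongr; linarith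
      _ = P ^ (a + 1) := by ring
      _ ≤ P ^ b := pow_le_pow_right₀ (by linarith) (by omega)
  have hPe : (P : ℝ) ≤ Real.exp P := by linarith [Real.add_one_le_exp (P : ℝ)]
  have hPpos : 0 < P := by omega
  let a : Matrix (Fin (32 * P ^ 53) × Fin (32 * P ^ 53) × Fin (P ^ 3))
      (Fin (P ^ 37) × Fin (P ^ 37) × Fin (P ^ 36)) (𝓞 K) :=
    fun t i => auxCoeff η p q n k t.1 t.2.1 t.2.2 i
  have ha0 : a ≠ 0 := by
    intro h
    have h1 := congrFun (congrFun h (⟨0, by positivity⟩, ⟨0, by positivity⟩, ⟨0, by positivity⟩))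
      (⟨0, by positivity⟩, ⟨0, by positivity⟩, ⟨0, by positivity⟩)
    simp [a, auxCoeff] at h1
  have hcard : 2 * Fintype.card (Fin (32 * P ^ 53) × Fin (32 * P ^ 53) × Fin (P ^ 3)) ≤
      Fintype.card (Fin (P ^ 37) × Fin (P ^ 37) × Fin (P ^ 36)) := by
    simp only [Fintype.card_prod, Fintype.card_fin]
    calc 2 * (32 * P ^ 53 * (32 * P ^ 53 * P ^ 3)) = 2048 * P ^ 109 := by ring
      _ ≤ P * P ^ 109 := by gcongr; omega
      _ = _ := by ring
  have hcard0 : 0 < Fintype.card (Fin (32 * P ^ 53) × Fin (32 * P ^ 53) × Fin (P ^ 3)) := by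
    simp only [Fintype.card_prod, Fintype.card_fin]
    positivity
  obtain ⟨ξ, hξ0, hξ, hb⟩ := hc a (Real.exp (129 * P ^ 54)) ha0 hcard0 hcard
    (Real.one_le_exp (by positivity)) (fun t i => by
      refine (house_auxCoeff_le (Real.one_le_exp hP0) hη hp hq (hu i) (hv i)).trans ?_
      rw [← Real.exp_nat_mul, ← Real.exp_nat_mul, ← Real.exp_add, Real.exp_le_exp]
      push_cast
      have h1 : ((t.1 : ℕ) : ℝ) ≤ 32 * P ^ 53 := by exact_mod_cast t.1.isLt.le
      have h2 : ((t.2.1 : ℕ) : ℝ) ≤ 32 * P ^ 53 := by exact_mod_cast t.2.1.isLt.le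
      have h3 : ((t.2.2 : ℕ) : ℝ) ≤ P ^ 3 := by exact_mod_cast t.2.2.isLt.le
      calc (((t.1 : ℕ) : ℝ) + ((t.2.1 : ℕ) : ℝ)) * (2 * P) +
            ((P : ℝ) ^ 37 + P ^ 36) * ((t.2.2 : ℕ) : ℝ) * P
          ≤ (32 * (P : ℝ) ^ 53 + 32 * (P : ℝ) ^ 53) * (2 * P) + ((P : ℝ) ^ 37 + P ^ 36) * P ^ 3 * P := by
            gcongr
        _ = 128 * (P : ℝ) ^ 54 + P ^ 41 + P ^ 40 := by ring
        _ ≤ 129 * (P : ℝ) ^ 54 := by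
          have := hmono 40 54 (by norm_num)
          have := hmono 41 54 (by norm_num)
          have : 0 ≤ (P : ℝ) ^ 54 := by positivity
          linarith)
  refine ⟨ξ, hξ0, fun i => (hb i).trans ?_, fun x hx t₁ ht₁ t₂ ht₂ => ?_⟩
  · simp only [Fintype.card_prod, Fintype.card_fin]
    have e : ((P ^ 37 * (P ^ 37 * P ^ 36) : ℕ) : ℝ) = (P : ℝ) ^ 110 := by push_cast; ring
    rw [e]
    calc c * (c * (P : ℝ) ^ 110 * Real.exp (129 * P ^ 54))
        ≤ Real.exp P * (Real.exp P * Real.exp P ^ 110 * Real.exp (129 * P ^ 54)) := by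
          have : c ≤ Real.exp P := hPc.trans hPe
          gcongr
      _ ≤ _ := by
        rw [← Real.exp_nat_mul, ← Real.exp_add, ← Real.exp_add, ← Real.exp_add, Real.exp_le_exp]
        have := hmono 1 54 (by norm_num)
        push_cast
        linarith
  · exact congrFun hξ (⟨t₁, ht₁⟩, ⟨t₂, ht₂⟩, ⟨x, hx⟩)

/-- A lower bound for linear forms in two logarithms of special shape. -/
theorem exists_baker_bound (φ : K →+* ℂ) {η : 𝓞 K} (hφη : ‖φ η‖ = 1)
    (hη : ∀ m : ℕ, 0 < m → η ^ m ≠ 1) :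
    ∃ P₀ : ℕ, ∀ P ≥ P₀, ∀ (n : ℕ) (p q : 𝓞 K), (n : ℝ) ≤ Real.exp P → p ≠ 0 → q ≠ 0 →
      house (p : K) ≤ Real.exp P → house (q : K) ≤ Real.exp P → q * η ^ n ≠ p →
      Real.exp (-(P : ℝ) ^ 200) ≤ ‖φ (q * η ^ n) - φ p‖ := by
  obtain ⟨P₁, hP₁⟩ := exists_auxInt_vanishing K
  refine ⟨max (max 20000 P₁) (max (10 * Module.finrank ℚ K) ⌈house (η : K)⌉₊),
    fun P hP n p q hn hp0 hq0 hp hq hne => ?_⟩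
  simp only [ge_iff_le, max_le_iff] at hP
  obtain ⟨⟨hP1, hPP₁⟩, hD, hPη⟩ := hP
  have hPr : (20000 : ℝ) ≤ P := by exact_mod_cast hP1
  have hP0 : (0 : ℝ) ≤ P := by linarith
  have hPe : (P : ℝ) ≤ Real.exp P := by linarith [Real.add_one_le_exp (P : ℝ)]
  have hηP : house (η : K) ≤ Real.exp P :=
    (Nat.le_ceil _).trans (le_trans (by exact_mod_cast hPη) hPe)
  rcases lt_or_ge n (P ^ 37) with hnS | hnS
  · exact liouville_lower_bound (by omega) hD φ hηP hp hq hnS hne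
  by_contra! hε
  set g := Complex.arg (φ η) with hg
  have hgπ : |g| ≤ Real.pi := Complex.abs_arg_le_pi _
  have hπ := Real.pi_pos
  have hπ3 := Real.pi_gt_three
  have hπ4 := Real.pi_lt_d2
  obtain ⟨k, hk⟩ : ∃ k : ℤ, |n * (g / (2 * Real.pi)) - k| ≤ 1 / 2 := ⟨_, abs_sub_round _⟩
  have hn1 : (1 : ℝ) ≤ n := by
    have : 1 ≤ n := le_trans (Nat.one_le_pow _ _ (by omega)) hnS
    exact_mod_cast this
  have hng : |n * (g / (2 * Real.pi))| ≤ n / 2 := by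
    rw [abs_mul, abs_div, abs_of_nonneg (by linarith : (0 : ℝ) ≤ n),
      abs_of_pos (by linarith : 0 < 2 * Real.pi), mul_div_assoc', div_le_iff₀ (by linarith)]
    nlinarith
  have hkn : |(k : ℝ)| ≤ n := by
    have := abs_sub_abs_le_abs_sub (k : ℝ) (n * (g / (2 * Real.pi)))
    rw [abs_sub_comm] at this
    linarith
  set θ₁ : ℂ := g * Complex.I with hθ₁
  set θ₂ : ℂ := 2 * Real.pi * Complex.I with hθ₂
  have hnθ₁ : ‖θ₁‖ ≤ Real.pi := by simpa [hθ₁] using hgπ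
  have hnθ₂ : ‖θ₂‖ = 2 * Real.pi := by simp [hθ₂, abs_of_pos hπ]
  have h₁ : Complex.exp θ₁ = φ η := by
    have := Complex.norm_mul_exp_arg_mul_I (φ η)
    rw [hφη] at this
    simpa using this
  have h₂ : Complex.exp θ₂ = 1 := Complex.exp_two_pi_mul_I
  have hnk : ‖(n : ℂ) * θ₁ - k * θ₂‖ ≤ Real.pi := by
    have e : (n : ℂ) * θ₁ - k * θ₂ =
        (((n * (g / (2 * Real.pi)) - k) * (2 * Real.pi) : ℝ) : ℂ) * Complex.I := by
      rw [hθ₁, hθ₂]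
      push_cast
      field_simp
    rw [e, norm_mul, Complex.norm_I, mul_one, Complex.norm_real, Real.norm_eq_abs, abs_mul,
      abs_of_pos (by linarith : 0 < 2 * Real.pi)]
    nlinarith
  have hi1 : ∀ i : Fin (P ^ 37) × Fin (P ^ 37) × Fin (P ^ 36), ((i.1 : ℕ) : ℝ) ≤ P ^ 37 :=
    fun i => by exact_mod_cast i.1.isLt.le
  have hi2 : ∀ i : Fin (P ^ 37) × Fin (P ^ 37) × Fin (P ^ 36), ((i.2.1 : ℕ) : ℝ) ≤ P ^ 37 :=
    fun i => by exact_mod_cast i.2.1.isLt.le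
  have hi3 : ∀ i : Fin (P ^ 37) × Fin (P ^ 37) × Fin (P ^ 36), ((i.2.2 : ℕ) : ℝ) ≤ P ^ 36 :=
    fun i => by exact_mod_cast i.2.2.isLt.le
  have hPP : (P : ℝ) ^ 36 ≤ P ^ 37 := pow_le_pow_right₀ (by linarith) (by norm_num)
  have hexpb : (P : ℝ) ^ 37 + P ^ 36 * n ≤ Real.exp (2 * P) := by
    have h1 := two_mul_pow_le_exp hPr
    have h2 : (1 : ℝ) ≤ Real.exp P := Real.one_le_exp hP0
    calc (P : ℝ) ^ 37 + P ^ 36 * n ≤ P ^ 37 * Real.exp P + P ^ 37 * Real.exp P := by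
          gcongr
          exact le_mul_of_one_le_right (by positivity) h2
      _ = (2 * (P : ℝ) ^ 37) * Real.exp P := by ring
      _ ≤ Real.exp P * Real.exp P := by gcongr
      _ = _ := by rw [← Real.exp_add]; ring_nf
  have hu : ∀ i : Fin (P ^ 37) × Fin (P ^ 37) × Fin (P ^ 36),
      |(firstExp n i : ℝ)| ≤ Real.exp (2 * P) := by
    intro i
    refine le_trans ?_ hexpb
    have : (firstExp n i : ℝ) = ((i.1 : ℕ) : ℝ) + ((i.2.2 : ℕ) : ℝ) * n := by
      simp [firstExp]
    rw [this, abs_of_nonneg (by positivity)]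
    gcongr
    · exact hi1 i
    · exact hi3 i
  have hv : ∀ i : Fin (P ^ 37) × Fin (P ^ 37) × Fin (P ^ 36),
      |(secondExp k i : ℝ)| ≤ Real.exp (2 * P) := by
    intro i
    refine le_trans ?_ hexpb
    have : (secondExp k i : ℝ) = ((i.2.1 : ℕ) : ℝ) - ((i.2.2 : ℕ) : ℝ) * k := by
      simp [secondExp]; ring
    rw [this]
    refine (abs_sub _ _).trans ?_
    rw [abs_mul, Nat.abs_cast, Nat.abs_cast]
    gcongr
    · exact hi2 i
    · exact hi3 i
  have hw : ∀ i : Fin (P ^ 37) × Fin (P ^ 37) × Fin (P ^ 36),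
      ‖firstExp n i * θ₁ + secondExp k i * θ₂‖ ≤ 13 * P ^ 37 := by
    intro i
    have e : (firstExp n i : ℂ) * θ₁ + secondExp k i * θ₂ = ((i.1 : ℕ) : ℂ) * θ₁ +
        ((i.2.1 : ℕ) : ℂ) * θ₂ + ((i.2.2 : ℕ) : ℂ) * ((n : ℂ) * θ₁ - k * θ₂) := by
      simp [firstExp, secondExp]; ring
    rw [e]
    calc _ ≤ ((i.1 : ℕ) : ℝ) * ‖θ₁‖ + ((i.2.1 : ℕ) : ℝ) * ‖θ₂‖ +
          ((i.2.2 : ℕ) : ℝ) * ‖(n : ℂ) * θ₁ - k * θ₂‖ := by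
          refine (norm_add_le _ _).trans (add_le_add ((norm_add_le _ _).trans ?_) ?_)
          · simp
          · simp
      _ ≤ (P : ℝ) ^ 37 * Real.pi + P ^ 37 * (2 * Real.pi) + P ^ 37 * Real.pi := by
          rw [hnθ₂]
          gcongr
          · exact hi1 i
          · exact hi2 i
          · exact (hi3 i).trans hPP
      _ = (4 * Real.pi) * P ^ 37 := by ring
      _ ≤ _ := by gcongr; linarith
  obtain ⟨ξ, hξ0, hξ, hvan⟩ := hP₁ P hPP₁ η p q n k hηP hp hq hu hv
  have hind : ∀ j ≤ 5, ∀ x < P ^ (3 + 14 * j), ∀ t₁ < 2 ^ (5 - j) * P ^ 53,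
      ∀ t₂ < 2 ^ (5 - j) * P ^ 53, auxInt ξ η p q n k t₁ t₂ x = 0 := by
    intro j
    induction j with
    | zero => exact fun _ => hvan
    | succ j ih =>
      intro hj x hx t₁ ht₁ t₂ ht₂
      have e1 : 2 * (2 ^ (5 - (j + 1)) * P ^ 53) = 2 ^ (5 - j) * P ^ 53 := by
        rw [← mul_assoc, ← pow_succ']; congr 2; omega
      refine auxInt_extrapolate (Y := P ^ (3 + 14 * j)) (M := 2 ^ (5 - (j + 1)) * P ^ 53)
        (by omega) hD (Nat.pow_le_pow_right (by omega) (by omega))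
        (Nat.pow_le_pow_right (by omega) (by omega))
        (Nat.le_mul_of_pos_left _ (by positivity)) (Nat.mul_le_mul_right _ ?_) φ h₁ h₂ ?_ ?_ hφη hq0
        hηP hp hq hξ hu hv hw hε.le ?_ ?_ ht₁ ht₂
      · calc 2 ^ (5 - (j + 1)) ≤ 2 ^ 4 := Nat.pow_le_pow_right (by norm_num) (by omega)
          _ = 16 := by norm_num
      · rw [hnθ₂]; linarith [norm_nonneg θ₁]
      · rw [hnθ₂]; linarith
      · rw [e1]; exact ih (by omega)
      · rw [← pow_add]; refine lt_of_lt_of_eq hx (by congr 1; ring)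
  refine hξ0 (eq_zero_of_auxInt_eq_zero (T := P ^ 53) (X := P ^ 73) hη ?_ hp0 hq0 hnS
    (Nat.pow_le_pow_right (by omega) (by norm_num)) (Nat.pow_le_pow_right (by omega) (by norm_num))
    (by rw [← pow_add]) (by simpa using hind 5 le_rfl))
  rintro rfl
  simp at hφη

end Baker

section Frame

variable {K : Type*} [Field K]

/-- `x` is the image in `K` of a unit of the ring of integers. -/
def IsIntegralUnit (x : K) : Prop := x ≠ 0 ∧ IsIntegral ℤ x ∧ IsIntegral ℤ x⁻¹

namespace IsIntegralUnit

variable {x y : K}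

lemma mul (hx : IsIntegralUnit x) (hy : IsIntegralUnit y) : IsIntegralUnit (x * y) :=
  ⟨mul_ne_zero hx.1 hy.1, hx.2.1.mul hy.2.1, by rw [mul_inv]; exact hx.2.2.mul hy.2.2⟩

lemma inv (hx : IsIntegralUnit x) : IsIntegralUnit x⁻¹ :=
  ⟨inv_ne_zero hx.1, hx.2.2, by rw [inv_inv]; exact hx.2.1⟩

lemma one : IsIntegralUnit (1 : K) := ⟨one_ne_zero, isIntegral_one, by simpa using isIntegral_one⟩

lemma zpow (hx : IsIntegralUnit x) (n : ℤ) : IsIntegralUnit (x ^ n) := by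
  induction n using Int.induction_on with
  | zero => simpa using one
  | succ n ih => rw [zpow_add_one₀ hx.1]; exact ih.mul hx
  | pred n ih => rw [zpow_sub_one₀ hx.1]; exact ih.mul hx.inv

lemma map [NumberField K] (hx : IsIntegralUnit x) (σ : K ≃ₐ[ℚ] K) : IsIntegralUnit (σ x) :=
  ⟨by simpa using hx.1, map_isIntegral_int (σ : K →+* K) hx.2.1,
    by rw [← map_inv₀]; exact map_isIntegral_int (σ : K →+* K) hx.2.2⟩

end IsIntegralUnit

lemma isIntegralUnit_coe_units (e : (𝓞 K)ˣ) : IsIntegralUnit ((e : 𝓞 K) : K) := by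
  have h : ((e : 𝓞 K) : K) * ((e⁻¹ : (𝓞 K)ˣ) : 𝓞 K) = 1 := by
    rw [← map_mul, Units.mul_inv, map_one]
  refine ⟨left_ne_zero_of_mul_eq_one h, RingOfIntegers.isIntegral_coe _, ?_⟩
  rw [inv_eq_of_mul_eq_one_right h]
  exact RingOfIntegers.isIntegral_coe _

variable [NumberField K]

/-- An embedding `φ` together with automorphisms `c` (complex conjugation) and `r` (of order
three) which generate a dihedral Galois group of order six. -/
structure IsDihedralFrame (φ : K →+* ℂ) (c r : K ≃ₐ[ℚ] K) : Prop where
  conj (x : K) : φ (c x) = starRingEnd ℂ (φ x)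
  pow_three (x : K) : r (r (r x)) = x
  comm (x : K) : c (r x) = r (r (c x))
  house_le {x : K} {H : ℝ} : ‖φ x‖ ≤ H → ‖φ (r x)‖ ≤ H → ‖φ (r (r x))‖ ≤ H → house x ≤ H

lemma finite_setOf_house_le (H : ℝ) : {x : K | IsIntegral ℤ x ∧ house x ≤ H}.Finite := by
  refine (Embeddings.finite_of_norm_le K ℂ H).subset fun x hx => ⟨hx.1, fun φ => ?_⟩
  exact (norm_embedding_le_house x φ).trans hx.2

namespace IsDihedralFrame

variable {φ : K →+* ℂ} {c r : K ≃ₐ[ℚ] K}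

lemma c_c (F : IsDihedralFrame φ c r) (x : K) : c (c x) = x := φ.injective (by simp [F.conj])

lemma norm_c (F : IsDihedralFrame φ c r) (x : K) : ‖φ (c x)‖ = ‖φ x‖ := by simp [F.conj]

lemma norm_r_c (F : IsDihedralFrame φ c r) (x : K) : ‖φ (r (c x))‖ = ‖φ (r (r x))‖ := by
  rw [← F.norm_c (r (r x)), F.comm, F.comm, F.pow_three]

lemma norm_r_r_c (F : IsDihedralFrame φ c r) (x : K) : ‖φ (r (r (c x)))‖ = ‖φ (r x)‖ := by
  rw [← F.comm, F.norm_c]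

lemma norm_of_c_eq_inv (F : IsDihedralFrame φ c r)
    {x : K} (hc : c x = x⁻¹) (hx : x ≠ 0) : ‖φ x‖ = 1 := by
  have h := F.norm_c x
  rw [hc, map_inv₀, norm_inv] at h
  have h0 : 0 < ‖φ x‖ := by simpa using hx
  have h1 : ‖φ x‖ * ‖φ x‖ = 1 := by nth_rewrite 1 [← h]; exact inv_mul_cancel₀ h0.ne'
  nlinarith

lemma norm_r_r_of_c_eq_inv (F : IsDihedralFrame φ c r)
    {x : K} (hc : c x = x⁻¹) : ‖φ (r (r x))‖ = ‖φ (r x)‖⁻¹ := by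
  rw [← F.norm_r_c, hc, map_inv₀, map_inv₀, norm_inv]

/-- Relative units, in bounded range, are finite in number. -/
lemma finite_of_abs_log_le (F : IsDihedralFrame φ c r) (B : ℝ) :
    {x : K | IsIntegralUnit x ∧ c x = x⁻¹ ∧ |Real.log ‖φ (r x)‖| ≤ B}.Finite := by
  refine (finite_setOf_house_le (Real.exp B)).subset fun x hx => ⟨hx.1.2.1, ?_⟩
  obtain ⟨hx, hc, hl⟩ := hx
  have hr : 0 < ‖φ (r x)‖ := by simpa using hx.1
  rw [abs_le] at hl
  refine F.house_le ?_ ?_ ?_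
  · rw [F.norm_of_c_eq_inv hc hx.1]
    exact Real.one_le_exp (by linarith)
  · rw [← Real.log_le_iff_le_exp hr]; exact hl.2
  · rw [F.norm_r_r_of_c_eq_inv hc, ← Real.log_le_iff_le_exp (inv_pos.2 hr), Real.log_inv]
    linarith

/-- The relative units are generated, up to a finite set, by one element. -/
lemma exists_generator (F : IsDihedralFrame φ c r)
    : ∃ η : K, IsIntegralUnit η ∧ c η = η⁻¹ ∧ 0 ≤ Real.log ‖φ (r η)‖ ∧
    ∀ x : K, IsIntegralUnit x → c x = x⁻¹ → ∃ (n : ℤ) (ζ : K), x = ζ * η ^ n ∧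
      Real.log ‖φ (r x)‖ = n * Real.log ‖φ (r η)‖ ∧
      IsIntegralUnit ζ ∧ c ζ = ζ⁻¹ ∧ Real.log ‖φ (r ζ)‖ = 0 := by
  let A : AddSubgroup ℝ :=
    { carrier := {y | ∃ x : K, IsIntegralUnit x ∧ c x = x⁻¹ ∧ Real.log ‖φ (r x)‖ = y}
      zero_mem' := ⟨1, .one, by simp, by simp⟩
      add_mem' := by
        rintro _ _ ⟨x, hx, hx', rfl⟩ ⟨y, hy, hy', rfl⟩
        refine ⟨x * y, hx.mul hy, by rw [map_mul, hx', hy', mul_inv], ?_⟩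
        rw [map_mul, map_mul, norm_mul, Real.log_mul] <;> simpa using by first | exact hx.1 | exact hy.1
      neg_mem' := by
        rintro _ ⟨x, hx, hx', rfl⟩
        exact ⟨x⁻¹, hx.inv, by rw [map_inv₀, hx'], by simp⟩ }
  have hfin : (((fun x => Real.log ‖φ (r x)‖) ''
      {x : K | IsIntegralUnit x ∧ c x = x⁻¹ ∧ |Real.log ‖φ (r x)‖| ≤ 1}) ∩ Set.Ioi 0).Finite :=
    ((F.finite_of_abs_log_le 1).image _).inter_of_left _
  obtain ⟨a, ha0, ha⟩ : ∃ a : ℝ, 0 < a ∧ Disjoint (A : Set ℝ) (Set.Ioo 0 a) := by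
    rcases Set.eq_empty_or_nonempty (((fun x => Real.log ‖φ (r x)‖) ''
      {x : K | IsIntegralUnit x ∧ c x = x⁻¹ ∧ |Real.log ‖φ (r x)‖| ≤ 1}) ∩ Set.Ioi 0) with he | hne
    · refine ⟨1, one_pos, Set.disjoint_left.2 ?_⟩
      rintro _ ⟨x, hx, hx', rfl⟩ hy
      have : Real.log ‖φ (r x)‖ ∈ (∅ : Set ℝ) := by
        rw [← he]
        exact ⟨⟨x, ⟨hx, hx', by rw [abs_of_pos hy.1]; exact hy.2.le⟩, rfl⟩, hy.1⟩
      exact this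
    · obtain ⟨a, ha, hmin⟩ := Set.exists_min_image _ id hfin hne
      refine ⟨min a 1, lt_min ha.2 one_pos, Set.disjoint_left.2 ?_⟩
      rintro _ ⟨x, hx, hx', rfl⟩ hy
      have := hmin _ ⟨⟨x, ⟨hx, hx', by
        rw [abs_of_pos hy.1]; exact (hy.2.le.trans (min_le_right _ _))⟩, rfl⟩, hy.1⟩
      exact absurd (hy.2.trans_le (min_le_left _ _)) (not_lt.2 this)
  obtain ⟨b, hb⟩ := AddSubgroup.cyclic_of_isolated_zero ha0 ha
  have hb' : A = AddSubgroup.closure {|b|} := by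
    rcases abs_choice b with h | h <;> rw [h]
    · exact hb
    · rw [hb]
      ext y
      simp only [AddSubgroup.mem_closure_singleton]
      constructor <;> rintro ⟨n, rfl⟩ <;> exact ⟨-n, by simp⟩
  have hbA : |b| ∈ A := by rw [hb']; exact AddSubgroup.mem_closure_singleton_self _
  obtain ⟨η, hη, hη', hηb⟩ := hbA
  refine ⟨η, hη, hη', hηb ▸ abs_nonneg b, fun x hx hx' => ?_⟩
  have hxA : Real.log ‖φ (r x)‖ ∈ A := ⟨x, hx, hx', rfl⟩
  rw [hb', AddSubgroup.mem_closure_singleton] at hxA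
  obtain ⟨n, hn⟩ := hxA
  have hη0 := hη.1
  have hn' : Real.log ‖φ (r x)‖ = n * Real.log ‖φ (r η)‖ := by rw [hηb, ← hn]; simp
  refine ⟨n, x * (η ^ n)⁻¹, ?_, hn', hx.mul (hη.zpow n).inv, ?_, ?_⟩
  · rw [inv_mul_cancel_right₀ (zpow_ne_zero _ hη0)]
  · rw [map_mul, map_inv₀, map_zpow₀, hx', hη', mul_inv, inv_zpow]
  · have h1 : ‖φ (r x)‖ ≠ 0 := by simpa using hx.1
    have h2 : ‖φ (r η)‖ ≠ 0 := by simpa using hη0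
    simp only [map_mul, map_inv₀, map_zpow₀, norm_mul, norm_inv, norm_zpow]
    rw [Real.log_mul h1 (inv_ne_zero (zpow_ne_zero _ h2)), Real.log_inv, Real.log_zpow, hn',
      add_neg_cancel]

end IsDihedralFrame

end Frame

section Core

variable {K : Type*} [Field K] [NumberField K]

lemma house_le_of_forall_norm_le {x : K} {H : ℝ} (h : ∀ ψ : K →+* ℂ, ‖ψ x‖ ≤ H) :
    house x ≤ H := by
  rw [house_eq_sup', ← NNReal.coe_mk H ((norm_nonneg _).trans (h (Classical.arbitrary _))),
    NNReal.coe_le_coe]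
  exact Finset.sup'_le _ _ fun ψ _ => h ψ

lemma house_neg_le (x : K) : house (-x) ≤ house x :=
  house_le_of_forall_norm_le fun ψ => by simpa using norm_embedding_le_house x ψ

lemma house_map_le (σ : K ≃ₐ[ℚ] K) (x : K) : house (σ x) ≤ house x :=
  house_le_of_forall_norm_le fun ψ => norm_embedding_le_house x (ψ.comp (σ : K →+* K))

lemma exists_baker_bound_of_isIntegral (φ : K →+* ℂ) {η : K} (hi : IsIntegral ℤ η)
    (hφη : ‖φ η‖ = 1) (hη : ∀ m : ℕ, 0 < m → η ^ m ≠ 1) :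
    ∃ P₀ : ℕ, ∀ P ≥ P₀, ∀ (n : ℕ) (p q : K), IsIntegral ℤ p → IsIntegral ℤ q →
      (n : ℝ) ≤ Real.exp P → p ≠ 0 → q ≠ 0 → house p ≤ Real.exp P → house q ≤ Real.exp P →
      q * η ^ n ≠ p → Real.exp (-(P : ℝ) ^ 200) ≤ ‖φ (q * η ^ n) - φ p‖ := by
  obtain ⟨η, rfl⟩ : ∃ y : 𝓞 K, (y : K) = η := ⟨⟨η, hi⟩, rfl⟩
  obtain ⟨P₀, h⟩ := exists_baker_bound φ hφη
    (fun m hm he => hη m hm (by rw [← map_pow, he, map_one]))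
  refine ⟨P₀, fun P hP n p q hp hq hn hp0 hq0 hhp hhq hne => ?_⟩
  obtain ⟨p, rfl⟩ : ∃ y : 𝓞 K, (y : K) = p := ⟨⟨p, hp⟩, rfl⟩
  obtain ⟨q, rfl⟩ : ∃ y : 𝓞 K, (y : K) = q := ⟨⟨q, hq⟩, rfl⟩
  have := h P hP n p q hn (by rintro rfl; simp at hp0) (by rintro rfl; simp at hq0) hhp hhq
    (fun he => hne (by rw [← he]; simp))
  simpa using this

lemma eventually_pow_add_le_exp (k : ℕ) (C : ℝ) {h : ℝ} (hh : 0 < h) :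
    ∀ᶠ P : ℕ in Filter.atTop, (P : ℝ) ^ k + C ≤ h * Real.exp ((P : ℝ) - 1) := by
  have h1 : Filter.Tendsto (fun x : ℝ => x ^ k * Real.exp (-x)) Filter.atTop (nhds 0) :=
    Real.tendsto_pow_mul_exp_neg_atTop_nhds_zero k
  have h2 : Filter.Tendsto (fun x : ℝ => C * Real.exp (-x)) Filter.atTop (nhds 0) := by
    simpa using (Real.tendsto_exp_neg_atTop_nhds_zero).const_mul C
  have h3 := (h1.add h2).eventually_lt_const (u := h * Real.exp (-1))
    (by rw [add_zero]; exact mul_pos hh (Real.exp_pos _))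
  filter_upwards [tendsto_natCast_atTop_atTop.eventually h3] with P hP
  rw [← add_mul] at hP
  rw [sub_eq_add_neg, Real.exp_add]
  have := mul_le_mul_of_nonneg_right hP.le (Real.exp_nonneg (P : ℝ))
  rw [mul_assoc, ← Real.exp_add, neg_add_cancel, Real.exp_zero, mul_one] at this
  linarith

lemma eventually_mul_pow_add_le_pow (C : ℝ) (D : ℝ) :
    ∀ᶠ P : ℕ in Filter.atTop, C * (P : ℝ) ^ 200 + D ≤ (P : ℝ) ^ 202 := by
  filter_upwards [Filter.eventually_ge_atTop (max 1 (⌈|C| + |D|⌉₊))] with P hP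
  have h1 : (1 : ℝ) ≤ P := by exact_mod_cast (le_max_left _ _).trans hP
  have h2 : |C| + |D| ≤ P := (Nat.le_ceil _).trans (by exact_mod_cast (le_max_right _ _).trans hP)
  have h3 : (1 : ℝ) ≤ (P : ℝ) ^ 200 := one_le_pow₀ h1
  calc C * (P : ℝ) ^ 200 + D ≤ |C| * (P : ℝ) ^ 200 + |D| * (P : ℝ) ^ 200 := by
        gcongr
        · exact le_abs_self C
        · exact (le_abs_self D).trans (le_mul_of_one_le_right (abs_nonneg D) h3)
    _ = (|C| + |D|) * (P : ℝ) ^ 200 := by ring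
    _ ≤ (P : ℝ) * (P : ℝ) ^ 200 := by gcongr
    _ = (P : ℝ) ^ 201 := by ring
    _ ≤ (P : ℝ) ^ 202 := pow_le_pow_right₀ h1 (by norm_num)

namespace IsDihedralFrame

variable {φ : K →+* ℂ} {c r : K ≃ₐ[ℚ] K}

lemma norms_eq_one (F : IsDihedralFrame φ c r)
    {ζ : K} (hζ : ζ ≠ 0) (hcζ : c ζ = ζ⁻¹) (hl : Real.log ‖φ (r ζ)‖ = 0) :
    ‖φ ζ‖ = 1 ∧ ‖φ (r ζ)‖ = 1 ∧ ‖φ (r (r ζ))‖ = 1 := by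
  have h1 : ‖φ (r ζ)‖ = 1 := Real.eq_one_of_pos_of_log_eq_zero (by simpa using hζ) hl
  exact ⟨F.norm_of_c_eq_inv hcζ hζ, h1, by rw [F.norm_r_r_of_c_eq_inv hcζ, h1, inv_one]⟩

lemma pow_ne_one {η : K} (hη : 0 < Real.log ‖φ (r η)‖) (m : ℕ) (hm : 0 < m) : η ^ m ≠ 1 := by
  intro h
  have h1 : Real.log ‖φ (r (η ^ m))‖ = 0 := by rw [h]; simp
  rw [map_pow, map_pow, norm_pow, Real.log_pow] at h1
  have : (0 : ℝ) < m := by exact_mod_cast hm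
  nlinarith

lemma log_sub_log_le_of_large_fst (F : IsDihedralFrame φ c r)
    {b η : K} (hb : IsIntegral ℤ b) (hb0 : b ≠ 0)
    (hη : IsIntegralUnit η) (hcη : c η = η⁻¹) (hlη : 0 < Real.log ‖φ (r η)‖) :
    ∃ (C : ℝ) (P₁ : ℕ), ∀ P ≥ P₁, ∀ (v ζ : K) (n : ℕ), IsIntegralUnit v → IsIntegralUnit ζ →
      c ζ = ζ⁻¹ → Real.log ‖φ (r ζ)‖ = 0 → v = ζ * η ^ n * c v →
      b * v + c (b * v) + (r (b * v) + c (r (b * v))) +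
        (r (r (b * v)) + c (r (r (b * v)))) = 0 →
      Real.log ‖φ (r b)‖ + n * Real.log ‖φ (r η)‖ ≠ Real.log ‖φ (r (r b))‖ →
      (n : ℝ) ≤ Real.exp P → Real.log ‖φ (r (r v))‖ ≤ Real.log ‖φ (r v)‖ →
      Real.log ‖φ v‖ - Real.log ‖φ (r v)‖ ≤ (P : ℝ) ^ 200 + C := by
  obtain ⟨P₀, hP₀⟩ := exists_baker_bound_of_isIntegral φ hη.2.1 (F.norm_of_c_eq_inv hcη hη.1)
    (IsDihedralFrame.pow_ne_one hlη)
  have hB : 0 < 2 * (‖φ (r b)‖ + ‖φ (r (r b))‖) := by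
    have : 0 < ‖φ (r b)‖ := by simpa using hb0
    positivity
  refine ⟨Real.log (2 * (‖φ (r b)‖ + ‖φ (r (r b))‖)), max P₀ ⌈house b⌉₊,
    fun P hP v ζ n hv hζ hcζ hlζ hvζ htr hne hn hL => ?_⟩
  have hv0 := hv.1
  have hPb : house b ≤ Real.exp P := by
    have h1 : house b ≤ P := (Nat.le_ceil _).trans (by exact_mod_cast (le_max_right _ _).trans hP)
    linarith [Real.add_one_le_exp (P : ℝ)]
  obtain ⟨hζ1, hζ2, hζ3⟩ := F.norms_eq_one hζ.1 hcζ hlζ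
  have key := hP₀ P ((le_max_left _ _).trans hP) n (-c b) (b * ζ)
    (map_isIntegral_int (c : K →+* K) hb).neg (hb.mul hζ.2.1) hn (by simpa using hb0)
    (mul_ne_zero hb0 hζ.1) ((house_neg_le _).trans ((house_map_le c b).trans hPb)) ?_ ?_
  · have e1 : φ (c v) * (φ (b * ζ * η ^ n) - φ (-c b)) =
        -(φ (r (b * v)) + φ (c (r (b * v))) + (φ (r (r (b * v))) + φ (c (r (r (b * v)))))) := by
      have e : b * v + c (b * v) = c v * (b * ζ * η ^ n - -c b) := by
        rw [map_mul]
        nth_rewrite 1 [hvζ]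
        ring
      rw [← map_sub, ← map_mul, ← e]
      have := congrArg φ htr
      simp only [map_add, map_zero] at this ⊢
      linear_combination this
    have e2 : ‖φ v‖ * Real.exp (-(P : ℝ) ^ 200) ≤
        2 * (‖φ (r b)‖ + ‖φ (r (r b))‖) * ‖φ (r v)‖ := by
      calc _ ≤ ‖φ v‖ * ‖φ (b * ζ * η ^ n) - φ (-c b)‖ := by gcongr
        _ = ‖φ (c v) * (φ (b * ζ * η ^ n) - φ (-c b))‖ := by rw [norm_mul, F.norm_c]
        _ ≤ ‖φ (r (b * v))‖ + ‖φ (r (b * v))‖ + (‖φ (r (r (b * v)))‖ + ‖φ (r (r (b * v)))‖) := by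
          rw [e1, norm_neg]
          refine (norm_add_le _ _).trans (add_le_add ?_ ?_)
          · refine (norm_add_le _ _).trans ?_
            rw [F.norm_c]
          · refine (norm_add_le _ _).trans ?_
            rw [F.norm_c]
        _ = 2 * (‖φ (r b)‖ * ‖φ (r v)‖ + ‖φ (r (r b))‖ * ‖φ (r (r v))‖) := by
          simp only [map_mul, norm_mul]; ring
        _ ≤ 2 * (‖φ (r b)‖ * ‖φ (r v)‖ + ‖φ (r (r b))‖ * ‖φ (r v)‖) := by
          rw [Real.log_le_log_iff (by simpa using hv0) (by simpa using hv0)] at hL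
          gcongr
        _ = _ := by ring
    have h0 : 0 < ‖φ v‖ := by simpa using hv0
    have h1 : 0 < ‖φ (r v)‖ := by simpa using hv0
    have e3 := Real.log_le_log (by positivity) e2
    rw [Real.log_mul h0.ne' (Real.exp_pos _).ne', Real.log_mul hB.ne' h1.ne', Real.log_exp] at e3
    linarith
  · refine le_trans (F.house_le ?_ ?_ ?_) hPb
    · rw [map_mul, norm_mul, hζ1, mul_one]; exact norm_embedding_le_house b φ
    · rw [map_mul, map_mul, norm_mul, hζ2, mul_one]
      exact (norm_embedding_le_house _ φ).trans (house_map_le r b)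
    · rw [map_mul, map_mul, map_mul, norm_mul, hζ3, mul_one]
      exact (norm_embedding_le_house _ φ).trans ((house_map_le r _).trans (house_map_le r b))
  · intro h
    apply hne
    have h1 : 0 < ‖φ (r b)‖ := by simpa using hb0
    have h2 : 0 < ‖φ (r η)‖ := by simpa using hη.1
    have := congrArg (fun x => Real.log ‖φ (r x)‖) h
    simp only [map_mul, map_neg, map_pow, norm_mul, norm_neg, norm_pow, hζ2, mul_one,
      F.norm_r_c] at this
    rwa [Real.log_mul h1.ne' (by positivity), Real.log_pow] at this

end IsDihedralFrame

end Core

section CoreTwo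

variable {K : Type*} [Field K] [NumberField K]

namespace IsDihedralFrame

variable {φ : K →+* ℂ} {c r : K ≃ₐ[ℚ] K}

lemma log_sub_log_le_of_large_snd (F : IsDihedralFrame φ c r)
    {b η : K} (hb : IsIntegral ℤ b) (hb0 : b ≠ 0)
    (hη : IsIntegralUnit η) (hcη : c η = η⁻¹) (hlη : 0 < Real.log ‖φ (r η)‖) :
    ∃ (C M : ℝ) (P₁ : ℕ), ∀ P ≥ P₁, ∀ (v ζ ζ' : K) (n t : ℕ), IsIntegralUnit v →
      IsIntegralUnit ζ → c ζ = ζ⁻¹ → Real.log ‖φ (r ζ)‖ = 0 → v = ζ * η ^ n * c v →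
      IsIntegralUnit ζ' → c ζ' = ζ'⁻¹ → Real.log ‖φ (r ζ')‖ = 0 →
      v = r ζ' * r η ^ t * c (r v) →
      b * v + c (b * v) + (r (b * v) + c (r (b * v))) +
        (r (r (b * v)) + c (r (r (b * v)))) = 0 →
      Real.log ‖φ b‖ + t * Real.log ‖φ (r η)‖ ≠ Real.log ‖φ (r b)‖ →
      (n : ℝ) ≤ Real.exp P → ((t : ℝ) + 1) * M ≤ P →
      Real.log ‖φ v‖ - Real.log ‖φ (r (r v))‖ ≤ (P : ℝ) ^ 200 + C := by
  obtain ⟨P₀, hP₀⟩ := exists_baker_bound_of_isIntegral φ hη.2.1 (F.norm_of_c_eq_inv hcη hη.1)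
    (IsDihedralFrame.pow_ne_one hlη)
  have hB : 0 < 2 * ‖φ (r (r b))‖ := by
    have : 0 < ‖φ (r (r b))‖ := by simpa using hb0
    positivity
  set E := max 1 (max (house b + house (c (r b))) (house ((r η)⁻¹))) with hE
  have hE1 : 1 ≤ E := le_max_left _ _
  have hE2 : house b + house (c (r b)) ≤ E := (le_max_left _ _).trans (le_max_right _ _)
  have hE3 : house ((r η)⁻¹) ≤ E := (le_max_right _ _).trans (le_max_right _ _)
  refine ⟨Real.log (2 * ‖φ (r (r b))‖), Real.log E, P₀,
    fun P hP v ζ ζ' n t hv hζ hcζ hlζ hvζ hζ' hcζ' hlζ' hvζ' htr hne hn ht => ?_⟩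
  have hv0 := hv.1
  obtain ⟨hζ1, hζ2, hζ3⟩ := F.norms_eq_one hζ.1 hcζ hlζ
  obtain ⟨hζ1', hζ2', hζ3'⟩ := F.norms_eq_one hζ'.1 hcζ' hlζ'
  have hrη : r η ≠ 0 := by simpa using hη.1
  have hrζ' : r ζ' ≠ 0 := by simpa using hζ'.1
  set g := b + c (r b) * ((r ζ')⁻¹ * (r η)⁻¹ ^ t) with hg
  have hbg : IsIntegral ℤ g :=
    hb.add ((map_isIntegral_int (c : K →+* K) (map_isIntegral_int (r : K →+* K) hb)).mul
      ((hζ'.map r).inv.2.1.mul ((hη.map r).inv.2.1.pow t)))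
  have hvg : v * g = b * v + c (r (b * v)) := by
    have h1 : c (r v) = v * ((r ζ')⁻¹ * (r η)⁻¹ ^ t) := by
      nth_rewrite 2 [hvζ']
      rw [inv_pow]
      field_simp
    rw [hg, map_mul, map_mul, h1]
    ring
  have hcvg : c v * c g = c (b * v) + r (b * v) := by
    rw [← map_mul, hvg, map_add, F.c_c]
  have hg0 : g ≠ 0 := by
    intro h0
    apply hne
    have h1 : b = -(c (r b) * ((r ζ')⁻¹ * (r η)⁻¹ ^ t)) := by
      rw [hg] at h0; linear_combination h0
    have h2 := congrArg (fun x => ‖φ x‖) h1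
    simp only [map_mul, map_neg, map_inv₀, map_pow, norm_mul, norm_neg, norm_pow, norm_inv, hζ2',
      F.norm_c, inv_one, one_mul] at h2
    have h3 : 0 < ‖φ (r b)‖ := by simpa using hb0
    have h4 : 0 < ‖φ (r η)‖ := by simpa using hη.1
    rw [h2, Real.log_mul h3.ne' (by positivity), Real.log_pow, Real.log_inv]
    ring
  have hgE : house g ≤ Real.exp P := by
    have h1 : house ((r ζ')⁻¹) ≤ 1 := by
      refine F.house_le ?_ ?_ ?_
      · simp [hζ2']
      · simp [hζ3']
      · simp [F.pow_three, hζ1']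
    calc house g ≤ house b + house (c (r b)) * (1 * house ((r η)⁻¹) ^ t) := by
          refine (house_add_le _ _).trans ?_
          gcongr
          refine (house_mul_le _ _).trans ?_
          have := house_nonneg (c (r b))
          gcongr
          refine (house_mul_le _ _).trans ?_
          have := house_nonneg ((r η)⁻¹)
          have := house_nonneg ((r η)⁻¹ ^ t)
          gcongr
          exact house_pow_le _ _
      _ ≤ house b * E ^ t + house (c (r b)) * (1 * E ^ t) := by
          have := house_nonneg (c (r b))
          have := house_nonneg ((r η)⁻¹)
          have := house_nonneg b
          gcongr
          exact le_mul_of_one_le_right this (one_le_pow₀ hE1)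
      _ = (house b + house (c (r b))) * E ^ t := by ring
      _ ≤ E * E ^ t := by gcongr
      _ = Real.exp ((t + 1) * Real.log E) := by
          rw [← pow_succ', ← Real.exp_log (by positivity : 0 < E), ← Real.exp_nat_mul,
            Real.exp_log (by positivity : 0 < E)]
          push_cast
          ring_nf
      _ ≤ _ := Real.exp_le_exp.2 ht
  have e : c v * ((ζ * g) * η ^ n - -c g) = -(r (r (b * v)) + c (r (r (b * v)))) := by
    have : c v * ((ζ * g) * η ^ n - -c g) = v * g + c v * c g := by
      nth_rewrite 2 [hvζ]
      ring
    rw [this, hvg, hcvg]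
    linear_combination htr
  have key := hP₀ P hP n (-c g) (ζ * g)
    (map_isIntegral_int (c : K →+* K) hbg).neg (hζ.2.1.mul hbg) hn (by simpa using hg0)
    (mul_ne_zero hζ.1 hg0) ((house_neg_le _).trans ((house_map_le c g).trans hgE)) ?_ ?_
  · have e2 : ‖φ v‖ * Real.exp (-(P : ℝ) ^ 200) ≤ 2 * ‖φ (r (r b))‖ * ‖φ (r (r v))‖ := by
      calc _ ≤ ‖φ v‖ * ‖φ ((ζ * g) * η ^ n) - φ (-c g)‖ := by gcongr
        _ = ‖φ (c v) * (φ ((ζ * g) * η ^ n) - φ (-c g))‖ := by rw [norm_mul, F.norm_c]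
        _ ≤ ‖φ (r (r (b * v)))‖ + ‖φ (r (r (b * v)))‖ := by
          rw [← map_sub, ← map_mul, e, map_neg, norm_neg, map_add]
          refine (norm_add_le _ _).trans ?_
          rw [F.norm_c]
        _ = _ := by
          simp only [map_mul, norm_mul]; ring
    have h0 : 0 < ‖φ v‖ := by simpa using hv0
    have h1 : 0 < ‖φ (r (r v))‖ := by simpa using hv0
    have e3 := Real.log_le_log (by positivity) e2
    rw [Real.log_mul h0.ne' (Real.exp_pos _).ne', Real.log_mul hB.ne' h1.ne', Real.log_exp] at e3
    linarith
  · refine le_trans (F.house_le ?_ ?_ ?_) hgE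
    · rw [map_mul, norm_mul, hζ1, one_mul]; exact norm_embedding_le_house g φ
    · rw [map_mul, map_mul, norm_mul, hζ2, one_mul]
      exact (norm_embedding_le_house _ φ).trans (house_map_le r g)
    · rw [map_mul, map_mul, map_mul, norm_mul, hζ3, one_mul]
      exact (norm_embedding_le_house _ φ).trans ((house_map_le r _).trans (house_map_le r g))
  · intro h
    apply hne
    rw [h, sub_self, mul_zero, eq_comm, neg_eq_zero] at e
    have h1 : 0 < ‖φ b‖ := by simpa using hb0
    have h2 : 0 < ‖φ (r η)‖ := by simpa using hη.1
    have h3 : 0 < ‖φ v‖ := by simpa using hv0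
    have h5 : 0 < ‖φ (r v)‖ := by simpa using hv0
    have h4 : ‖φ b‖ * ‖φ v‖ = ‖φ (r b)‖ * ‖φ (r v)‖ := by
      have := congrArg (fun x => ‖φ (r x)‖) (eq_neg_of_add_eq_zero_left e)
      simpa only [map_neg, norm_neg, F.pow_three, F.norm_r_c, map_mul, norm_mul] using this
    have h6 := congrArg (fun x => Real.log ‖φ x‖) hvζ'
    simp only [map_mul, norm_mul, hζ2', map_pow, norm_pow, F.norm_c, one_mul] at h6
    rw [Real.log_mul (by positivity) h5.ne', Real.log_pow] at h6
    have h7 := congrArg Real.log h4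
    rw [Real.log_mul h1.ne' h3.ne', Real.log_mul (by simpa using hb0) h5.ne'] at h7
    linarith

end IsDihedralFrame

end CoreTwo

section CoreThree

variable {K : Type*} [Field K] [NumberField K]

namespace IsDihedralFrame

variable {φ : K →+* ℂ} {c r : K ≃ₐ[ℚ] K}

lemma c_div_c (F : IsDihedralFrame φ c r) {v : K} : c (v / c v) = (v / c v)⁻¹ := by
  rw [map_div₀, F.c_c, inv_div]

lemma log_norm_r_div_c (F : IsDihedralFrame φ c r)
    {v : K} (hv : v ≠ 0) : Real.log ‖φ (r (v / c v))‖ =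
    Real.log ‖φ (r v)‖ - Real.log ‖φ (r (r v))‖ := by
  rw [map_div₀, map_div₀, norm_div, F.norm_r_c, Real.log_div (by simpa using hv)
    (by simpa using hv)]

/-- Among the units `v` with `Tr (b v) = 0`, two of the three absolute values are close,
provided that these are sorted. -/
lemma exists_bound_of_sorted (F : IsDihedralFrame φ c r)
    {b : K} (hb : IsIntegral ℤ b) (hb0 : b ≠ 0) :
    ∃ N : ℝ, ∀ v : K, IsIntegralUnit v →
      b * v + c (b * v) + (r (b * v) + c (r (b * v))) +
        (r (r (b * v)) + c (r (r (b * v)))) = 0 →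
      Real.log ‖φ (r v)‖ ≤ Real.log ‖φ v‖ → Real.log ‖φ (r (r v))‖ ≤ Real.log ‖φ (r v)‖ →
      Real.log ‖φ v‖ - Real.log ‖φ (r v)‖ ≤ N ∨
        Real.log ‖φ (r v)‖ - Real.log ‖φ (r (r v))‖ ≤ N := by
  obtain ⟨η, hη, hcη, hlη, hgen⟩ := F.exists_generator
  rcases hlη.eq_or_lt with h0 | hlη
  · refine ⟨0, fun v hv _ _ _ => Or.inr ?_⟩
    obtain ⟨n, ζ, -, hn, -⟩ := hgen (v / c v) (by
      rw [div_eq_mul_inv]; exact hv.mul (hv.map c).inv) F.c_div_c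
    rw [F.log_norm_r_div_c hv.1, ← h0, mul_zero] at hn
    exact hn.le
  obtain ⟨C₁, P₁, h₁⟩ := F.log_sub_log_le_of_large_fst hb hb0 hη hcη hlη
  obtain ⟨C₂, M, P₂, h₂⟩ := F.log_sub_log_le_of_large_snd hb hb0 hη hcη hlη
  set h := Real.log ‖φ (r η)‖ with hh
  obtain ⟨R, hR⟩ := Filter.eventually_atTop.1
    ((eventually_pow_add_le_exp (202 * 200) C₂ hlη).and
      (eventually_mul_pow_add_le_pow (|M| / h) ((C₁ / h + 1) * |M|)))
  set R' := max (max R 1) (max P₁ P₂) with hR'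
  set B := |Real.log ‖φ b‖| + |Real.log ‖φ (r b)‖| + |Real.log ‖φ (r (r b))‖| with hB
  refine ⟨B + h * Real.exp R', fun v hv htr hL1 hL2 => ?_⟩
  by_contra! hcon
  obtain ⟨hc1, hc2⟩ := hcon
  have hv0 := hv.1
  have hE : 0 < h * Real.exp R' := by positivity
  have hb1 := abs_nonneg (Real.log ‖φ b‖)
  have hb2 := abs_nonneg (Real.log ‖φ (r b)‖)
  have hb3 := abs_nonneg (Real.log ‖φ (r (r b))‖)
  obtain ⟨n, ζ, hx, hn, hζ, hcζ, hlζ⟩ := hgen (v / c v) (by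
    rw [div_eq_mul_inv]; exact hv.mul (hv.map c).inv) F.c_div_c
  have hw : IsIntegralUnit (r (r v)) := (hv.map r).map r
  obtain ⟨t, ζ', hx', ht, hζ', hcζ', hlζ'⟩ := hgen (r (r v) / c (r (r v))) (by
    rw [div_eq_mul_inv]; exact hw.mul (hw.map c).inv) F.c_div_c
  rw [F.log_norm_r_div_c hv.1] at hn
  rw [F.log_norm_r_div_c hw.1, F.pow_three] at ht
  have hn0 : 0 ≤ n := by
    by_contra! hneg
    have : (n : ℝ) < 0 := by exact_mod_cast hneg
    nlinarith
  have ht0 : 0 ≤ t := by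
    by_contra! hneg
    have : (t : ℝ) < 0 := by exact_mod_cast hneg
    nlinarith
  lift n to ℕ using hn0
  lift t to ℕ using ht0
  rw [zpow_natCast] at hx hx'
  rw [Int.cast_natCast] at hn ht
  have hvζ : v = ζ * η ^ n * c v := by
    rw [← hx, div_mul_cancel₀ _ (by simpa using hv0)]
  have hvζ' : v = r ζ' * r η ^ t * c (r v) := by
    have e1 : r (r v) = ζ' * η ^ t * c (r (r v)) := by
      rw [← hx', div_mul_cancel₀ _ (by simpa using hv0)]
    have e2 := congrArg r e1
    rwa [F.pow_three, map_mul, map_mul, map_pow, F.comm (r v), F.pow_three] at e2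
  have hnbig : Real.exp R' < n := by
    have : h * Real.exp R' < h * n := by linarith
    exact lt_of_mul_lt_mul_left this hlη.le
  have hnpos : (0 : ℝ) < n := (Real.exp_pos _).trans hnbig
  have hlog : (R' : ℝ) < Real.log n := by rwa [Real.lt_log_iff_exp_lt hnpos]
  set P := ⌈Real.log n⌉₊ with hP
  have hPlog : Real.log n ≤ P := Nat.le_ceil _
  have hPR : R' ≤ P := by exact_mod_cast (hlog.le.trans hPlog)
  have hnP : (n : ℝ) ≤ Real.exp P := by rwa [← Real.log_le_iff_le_exp hnpos]
  have hPn : Real.exp ((P : ℝ) - 1) < n := by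
    rw [← Real.lt_log_iff_exp_lt hnpos, sub_lt_iff_lt_add]
    exact Nat.ceil_lt_add_one (by linarith [(Nat.cast_nonneg R' : (0 : ℝ) ≤ R')])
  have hP1 : 1 ≤ P := (le_max_right R 1).trans ((le_max_left _ _).trans hPR)
  obtain ⟨hRa, hRb⟩ := hR P ((le_max_left R 1).trans ((le_max_left _ _).trans hPR))
  have hPP : P ≤ P ^ 202 := Nat.le_self_pow (by norm_num) P
  have s1 := h₁ P ((le_max_left _ _).trans ((le_max_right _ _).trans hPR)) v ζ n hv hζ hcζ hlζ
    hvζ htr (by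
      intro he
      have := neg_abs_le (Real.log ‖φ (r b)‖)
      have := le_abs_self (Real.log ‖φ (r (r b))‖)
      linarith) hnP hL2
  have s2 := h₂ (P ^ 202)
    (((le_max_right _ _).trans ((le_max_right _ _).trans hPR)).trans hPP) v ζ ζ' n t hv hζ hcζ
    hlζ hvζ hζ' hcζ' hlζ' hvζ' htr (by
      intro he
      have := neg_abs_le (Real.log ‖φ b‖)
      have := le_abs_self (Real.log ‖φ (r b)‖)
      linarith) (hnP.trans (Real.exp_le_exp.2 (by exact_mod_cast hPP))) (by
      have ht1 : (t : ℝ) ≤ ((P : ℝ) ^ 200 + C₁) / h := by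
        rw [le_div_iff₀ hlη]; linarith
      calc ((t : ℝ) + 1) * M ≤ ((t : ℝ) + 1) * |M| := by gcongr; exact le_abs_self M
        _ ≤ (((P : ℝ) ^ 200 + C₁) / h + 1) * |M| := by gcongr
        _ = |M| / h * (P : ℝ) ^ 200 + (C₁ / h + 1) * |M| := by field_simp; ring
        _ ≤ (P : ℝ) ^ 202 := hRb
        _ = _ := by push_cast; rfl)
  rw [pow_mul] at hRa
  push_cast at s2
  have := mul_lt_mul_of_pos_left hPn hlη
  linarith

end IsDihedralFrame

end CoreThree

section FrameConclusion

variable {K : Type*} [Field K] [NumberField K]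

namespace IsDihedralFrame

variable {φ : K →+* ℂ} {c r : K ≃ₐ[ℚ] K}

lemma exists_bound_of_isIntegral (F : IsDihedralFrame φ c r)
    {b : K} (hb : IsIntegral ℤ b) (hb0 : b ≠ 0) :
    ∃ N : ℝ, ∀ v : K, IsIntegralUnit v →
      b * v + c (b * v) + (r (b * v) + c (r (b * v))) +
        (r (r (b * v)) + c (r (r (b * v)))) = 0 →
      |Real.log ‖φ (r v)‖ - Real.log ‖φ (r (r v))‖| ≤ N ∨
      |Real.log ‖φ (r (r v))‖ - Real.log ‖φ v‖| ≤ N ∨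
      |Real.log ‖φ v‖ - Real.log ‖φ (r v)‖| ≤ N := by
  have hcr : ∀ x, c (r x) = r (r (c x)) := F.comm
  have hi : ∀ (σ : K ≃ₐ[ℚ] K) {x : K}, IsIntegral ℤ x → IsIntegral ℤ (σ x) :=
    fun σ _ hx => map_isIntegral_int (σ : K →+* K) hx
  have h0 : ∀ (σ : K ≃ₐ[ℚ] K) {x : K}, x ≠ 0 → σ x ≠ 0 := fun σ x hx => by simpa using hx
  obtain ⟨N₁, h₁⟩ := F.exists_bound_of_sorted hb hb0
  obtain ⟨N₂, h₂⟩ := F.exists_bound_of_sorted (hi r hb) (h0 r hb0)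
  obtain ⟨N₃, h₃⟩ := F.exists_bound_of_sorted (hi r (hi r hb)) (h0 r (h0 r hb0))
  obtain ⟨N₄, h₄⟩ := F.exists_bound_of_sorted (hi c hb) (h0 c hb0)
  obtain ⟨N₅, h₅⟩ := F.exists_bound_of_sorted (hi c (hi r hb)) (h0 c (h0 r hb0))
  obtain ⟨N₆, h₆⟩ := F.exists_bound_of_sorted (hi c (hi r (hi r hb))) (h0 c (h0 r (h0 r hb0)))
  refine ⟨|N₁| + |N₂| + |N₃| + |N₄| + |N₅| + |N₆|, fun v hv htr => ?_⟩
  replace h₁ := h₁ v hv htr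
  replace h₂ := h₂ (r v) (hv.map r) (by
    simp only [← map_mul, F.pow_three]; linear_combination htr)
  replace h₃ := h₃ (r (r v)) ((hv.map r).map r) (by
    simp only [← map_mul, F.pow_three]; linear_combination htr)
  replace h₄ := h₄ (c v) (hv.map c) (by
    simp only [← map_mul, F.pow_three, hcr, F.c_c] at htr ⊢; linear_combination htr)
  replace h₅ := h₅ (c (r v)) ((hv.map r).map c) (by
    simp only [← map_mul, F.pow_three, hcr, F.c_c] at htr ⊢; linear_combination htr)
  replace h₆ := h₆ (c (r (r v))) (((hv.map r).map r).map c) (by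
    simp only [← map_mul, F.pow_three, hcr, F.c_c] at htr ⊢; linear_combination htr)
  simp only [F.pow_three, F.norm_c, F.norm_r_c, F.norm_r_r_c] at h₁ h₂ h₃ h₄ h₅ h₆
  set a₀ := Real.log ‖φ v‖
  set a₁ := Real.log ‖φ (r v)‖
  set a₂ := Real.log ‖φ (r (r v))‖
  have := le_abs_self N₁
  have := le_abs_self N₂
  have := le_abs_self N₃
  have := le_abs_self N₄
  have := le_abs_self N₅
  have := le_abs_self N₆
  have := abs_nonneg N₁
  have := abs_nonneg N₂
  have := abs_nonneg N₃
  have := abs_nonneg N₄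
  have := abs_nonneg N₅
  have := abs_nonneg N₆
  have aux : ∀ {x y N N' : ℝ}, y ≤ x → x - y ≤ N → N ≤ N' → |x - y| ≤ N' ∧ |y - x| ≤ N' :=
    fun hxy h h' => ⟨by rw [abs_of_nonneg] <;> linarith, by rw [abs_of_nonpos] <;> linarith⟩
  rcases le_total a₀ a₁ with h01 | h01 <;> rcases le_total a₁ a₂ with h12 | h12 <;>
    rcases le_total a₀ a₂ with h02 | h02
  · rcases h₆ h12 h01 with h | h
    · exact Or.inl (aux h12 h (by linarith)).2
    · exact Or.inr (Or.inr (aux h01 h (by linarith)).2)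
  · rcases h₆ h12 h01 with h | h
    · exact Or.inl (aux h12 h (by linarith)).2
    · exact Or.inr (Or.inr (aux h01 h (by linarith)).2)
  · rcases h₂ h12 h02 with h | h
    · exact Or.inl (aux h12 h (by linarith)).1
    · exact Or.inr (Or.inl (aux h02 h (by linarith)).1)
  · rcases h₅ h01 h02 with h | h
    · exact Or.inr (Or.inr (aux h01 h (by linarith)).2)
    · exact Or.inr (Or.inl (aux h02 h (by linarith)).2)
  · rcases h₃ h02 h01 with h | h
    · exact Or.inr (Or.inl (aux h02 h (by linarith)).1)
    · exact Or.inr (Or.inr (aux h01 h (by linarith)).1)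
  · rcases h₄ h02 h12 with h | h
    · exact Or.inr (Or.inl (aux h02 h (by linarith)).2)
    · exact Or.inl (aux h12 h (by linarith)).2
  · rcases h₁ h01 h12 with h | h
    · exact Or.inr (Or.inr (aux h01 h (by linarith)).1)
    · exact Or.inl (aux h12 h (by linarith)).1
  · rcases h₁ h01 h12 with h | h
    · exact Or.inr (Or.inr (aux h01 h (by linarith)).1)
    · exact Or.inl (aux h12 h (by linarith)).1

lemma exists_finite (F : IsDihedralFrame φ c r) {b δ : K} (hb0 : b ≠ 0) (hδ : δ ≠ 0) (hc : c ≠ 1) :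
    ∃ S : Set ((K ≃ₐ[ℚ] K) × (K ≃ₐ[ℚ] K) × K), S.Finite ∧
      (∀ p ∈ S, p.1 ≠ p.2.1 ∧ p.2.2 ≠ 0) ∧
      ∀ v : K, IsIntegralUnit v →
        b * v + c (b * v) + (r (b * v) + c (r (b * v))) +
          (r (r (b * v)) + c (r (r (b * v)))) = 0 →
        ∃ p ∈ S, p.1 (δ * v) = p.2.2 * p.2.1 (δ * v) := by
  obtain ⟨y, hy0, hy⟩ := exists_integral_multiples ℤ ℚ {b}
  replace hy := hy b (Finset.mem_singleton_self b)
  obtain ⟨N, hN⟩ := F.exists_bound_of_isIntegral hy (smul_ne_zero hy0 hb0)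
  set X := {x : K | IsIntegralUnit x ∧ c x = x⁻¹ ∧ |Real.log ‖φ (r x)‖| ≤ N} with hX
  have hXfin : X.Finite := F.finite_of_abs_log_le N
  let f : (K ≃ₐ[ℚ] K) × K → (K ≃ₐ[ℚ] K) × (K ≃ₐ[ℚ] K) × K :=
    fun p => (p.1, c * p.1, p.1 δ / c (p.1 δ) * p.2)
  refine ⟨f '' (({1, r, r * r} : Set (K ≃ₐ[ℚ] K)) ×ˢ X), ((Set.toFinite _).prod hXfin).image _,
    ?_, fun v hv htr => ?_⟩
  · rintro _ ⟨⟨σ, x⟩, ⟨-, hx⟩, rfl⟩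
    refine ⟨fun h => hc ?_, ?_⟩
    · simpa [f] using h
    · exact mul_ne_zero (div_ne_zero (by simpa using hδ) (by simpa using hδ)) hx.1.1
  · have key : ∀ σ ∈ ({1, r, r * r} : Set (K ≃ₐ[ℚ] K)),
        |Real.log ‖φ (r (σ v))‖ - Real.log ‖φ (r (r (σ v)))‖| ≤ N →
        ∃ p ∈ f '' (({1, r, r * r} : Set (K ≃ₐ[ℚ] K)) ×ˢ X),
          p.1 (δ * v) = p.2.2 * p.2.1 (δ * v) := by
      intro σ hσ hle
      have hσv := hv.map σ
      refine ⟨_, ⟨(σ, σ v / c (σ v)), ⟨hσ, ?_, F.c_div_c, ?_⟩, rfl⟩, ?_⟩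
      · rw [div_eq_mul_inv]; exact hσv.mul (hσv.map c).inv
      · rw [F.log_norm_r_div_c hσv.1]; exact hle
      · have h1 : c (σ v) ≠ 0 := by simpa using hv.1
        have h2 : c (σ δ) ≠ 0 := by simpa using hδ
        simp only [f, map_mul, AlgEquiv.mul_apply]
        field_simp
    rcases hN v hv (by
      rw [smul_mul_assoc]
      simp only [map_zsmul]
      rw [← smul_add, ← smul_add, ← smul_add, ← smul_add, ← smul_add, htr, smul_zero]) with h | h | h
    · exact key 1 (by simp) (by simpa using h)
    · exact key r (by simp) (by simpa [F.pow_three] using h)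
    · exact key (r * r) (by simp) (by simpa [F.pow_three] using h)

end IsDihedralFrame

end FrameConclusion

section GroupOrderSix

variable {G : Type*} [Group G] [Finite G]

lemma exists_pow_three_of_card_eq_six (hG : Nat.card G = 6) {c : G} (hc : c ≠ 1)
    (hcc : c * c = 1) : ∃ r : G, r ^ 3 = 1 ∧ (c * r = r * c ∨ c * r = r ^ 2 * c) ∧
      Function.Bijective fun p : Fin 2 × Fin 3 => c ^ (p.1 : ℕ) * r ^ (p.2 : ℕ) := by
  have : Fact (Nat.Prime 3) := ⟨Nat.prime_three⟩
  obtain ⟨r, hr⟩ := exists_prime_orderOf_dvd_card' (G := G) 3 (by rw [hG]; norm_num)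
  have hr3 : r ^ 3 = 1 := by rw [← hr]; exact pow_orderOf_eq_one r
  have hmem : ∀ g ∈ Subgroup.zpowers r, ∃ j : Fin 3, g = r ^ (j : ℕ) := by
    rintro _ ⟨k, rfl⟩
    have h1 : 0 ≤ k % 3 := Int.emod_nonneg _ (by norm_num)
    have h2 : k % 3 < 3 := Int.emod_lt_of_pos _ (by norm_num)
    refine ⟨⟨(k % 3).toNat, by omega⟩, ?_⟩
    have h3 := zpow_mod_orderOf r k
    rw [hr] at h3
    simp only
    rw [← h3, ← zpow_natCast, Int.toNat_of_nonneg h1]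
    rfl
  have hidx : (Subgroup.zpowers r).index = 2 := by
    have := (Subgroup.zpowers r).card_mul_index
    rw [Nat.card_zpowers, hr, hG] at this
    omega
  have hcr : c ∉ Subgroup.zpowers r := by
    intro h
    have h1 : orderOf c ∣ 3 := by
      rw [← hr, ← Nat.card_zpowers r]
      exact Subgroup.orderOf_dvd_natCard _ h
    have h2 : orderOf c ∣ 2 := orderOf_dvd_of_pow_eq_one (by rw [pow_two, hcc])
    exact hc (orderOf_eq_one_iff.1 (Nat.dvd_one.1 (by simpa using Nat.dvd_gcd h1 h2)))
  have hcinv : c⁻¹ = c := inv_eq_of_mul_eq_one_left hcc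
  refine ⟨r, hr3, ?_, ?_⟩
  · have hn := Subgroup.normal_of_index_eq_two hidx
    obtain ⟨j, hj⟩ := hmem _ (hn.conj_mem r (Subgroup.mem_zpowers r) c)
    rw [mul_inv_eq_iff_eq_mul] at hj
    fin_cases j
    · exfalso
      have : r = 1 := by simpa using hj
      rw [this] at hr
      simp at hr
    · left; simpa using hj
    · right; simpa using hj
  · have : Fintype G := Fintype.ofFinite G
    rw [Fintype.bijective_iff_surjective_and_card]
    refine ⟨fun g => ?_, by rw [← Nat.card_eq_fintype_card (α := G), hG]; simp⟩
    by_cases hg : g ∈ Subgroup.zpowers r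
    · obtain ⟨j, rfl⟩ := hmem g hg
      exact ⟨(0, j), by simp⟩
    · have : c * g ∈ Subgroup.zpowers r := by
        rw [Subgroup.mul_mem_iff_of_index_two hidx]
        tauto
      obtain ⟨j, hj⟩ := hmem _ this
      exact ⟨(1, j), by simp only [Fin.val_one, pow_one]; rw [← hj, ← mul_assoc, hcc, one_mul]⟩

end GroupOrderSix

section NormForm

variable {K : Type*} [Field K] [NumberField K]

lemma exists_algEquiv_of_embeddings [IsGalois ℚ K] (φ ψ : K →+* ℂ) :
    ∃ g : K ≃ₐ[ℚ] K, ∀ x, ψ x = φ (g x) := by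
  obtain ⟨σ, hσ⟩ := ComplexEmbedding.exists_comp_symm_eq_of_comp_eq (k := ℚ) φ ψ
    (Subsingleton.elim _ _)
  exact ⟨σ.symm, fun x => by rw [← hσ]; rfl⟩

/-- Up to units, a norm form equation has finitely many solutions. -/
lemma exists_finite_representatives {ι : Type*} [Fintype ι] (α : ι → K) {m : ℤ} (hm : m ≠ 0) :
    ∃ Δ : Set K, Δ.Finite ∧ (∀ δ ∈ Δ, δ ≠ 0) ∧ ∀ x : ι → ℤ,
      Algebra.norm ℚ (∑ i, (x i : K) * α i) = (m : ℚ) →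
      ∃ δ ∈ Δ, ∃ v, IsIntegralUnit v ∧ ∑ i, (x i : K) * α i = δ * v := by
  classical
  obtain ⟨d, hd0, hd⟩ := exists_integral_multiples ℤ ℚ (Finset.univ.image α)
  have hdK : (d : K) ≠ 0 := by exact_mod_cast hd0
  set M := (d ^ Module.finrank ℚ K * m).natAbs with hM
  have hM0 : M ≠ 0 := Int.natAbs_ne_zero.2 (mul_ne_zero (pow_ne_zero _ hd0) hm)
  let g : Ideal (𝓞 K) → 𝓞 K :=
    fun I => if h : ∃ w, Ideal.span {w} = I then h.choose else 1
  refine ⟨(fun I => (g I : K) / d) '' {I | Ideal.absNorm I = M},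
    (Ideal.finite_setOfPred_absNorm_eq M).image _, ?_, fun x hx => ?_⟩
  · rintro _ ⟨I, hI, rfl⟩
    refine div_ne_zero ?_ hdK
    rw [RingOfIntegers.coe_ne_zero_iff]
    by_cases h : ∃ w, Ideal.span {w} = I
    · simp only [g, dif_pos h]
      intro h0
      have := h.choose_spec
      rw [h0] at this
      rw [Set.mem_ofPred_eq, ← this] at hI
      simp at hI
      exact hM0 hI.symm
    · simp [g, dif_neg h]
  · set u := ∑ i, (x i : K) * α i with hu
    have hdu : IsIntegral ℤ ((d : K) * u) := by
      rw [hu, Finset.mul_sum]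
      refine IsIntegral.sum _ fun i _ => ?_
      rw [mul_left_comm]
      have := hd (α i) (Finset.mem_image_of_mem _ (Finset.mem_univ i))
      rw [zsmul_eq_mul] at this
      exact IsIntegral.mul (isIntegral_algebraMap (R := ℤ) (x := x i)) this
    obtain ⟨w, hw⟩ : ∃ w : 𝓞 K, (w : K) = d * u := ⟨⟨_, hdu⟩, rfl⟩
    have hnorm : Algebra.norm ℤ w = d ^ Module.finrank ℚ K * m := by
      have h1 : ((Algebra.norm ℤ w : ℤ) : ℚ) = Algebra.norm ℚ (w : K) :=
        Algebra.coe_norm_int w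
      rw [hw, map_mul, hx] at h1
      have h2 : Algebra.norm ℚ (d : K) = (d : ℚ) ^ Module.finrank ℚ K := by
        have := Algebra.norm_algebraMap (S := K) (d : ℚ)
        simpa using this
      rw [h2] at h1
      exact_mod_cast h1
    have hspan : Ideal.absNorm (Ideal.span {w}) = M := by
      rw [Ideal.absNorm_span_singleton, hnorm]
    have hex : ∃ w', Ideal.span {w'} = Ideal.span {w} := ⟨w, rfl⟩
    have hgI : Ideal.span {g (Ideal.span {w})} = Ideal.span {w} := by
      simp only [g, dif_pos hex]
      exact hex.choose_spec
    obtain ⟨e, he⟩ := Ideal.span_singleton_eq_span_singleton.1 hgI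
    refine ⟨_, ⟨_, hspan, rfl⟩, (e : 𝓞 K), isIntegralUnit_coe_units e, ?_⟩
    have h3 : (g (Ideal.span {w}) : K) * ((e : 𝓞 K) : K) = d * u := by
      rw [← hw, ← map_mul, he]
    field_simp
    linear_combination -h3

lemma exists_ne_zero_trace_eq_zero {ι : Type*} [Fintype ι] (α : ι → K)
    (h : Fintype.card ι < Module.finrank ℚ K) :
    ∃ β : K, β ≠ 0 ∧ ∀ x : ι → ℤ, Algebra.trace ℚ K (β * ∑ i, (x i : K) * α i) = 0 := by
  let L : K →ₗ[ℚ] (ι → ℚ) :=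
    LinearMap.pi fun i => Algebra.trace ℚ K ∘ₗ LinearMap.mulRight ℚ (α i)
  have hL : LinearMap.ker L ≠ ⊥ := LinearMap.ker_ne_bot_of_finrank_lt (by simpa using h)
  obtain ⟨β, hβ, hβ0⟩ := (Submodule.ne_bot_iff _).1 hL
  refine ⟨β, hβ0, fun x => ?_⟩
  rw [Finset.mul_sum, map_sum]
  refine Finset.sum_eq_zero fun i _ => ?_
  have h1 : Algebra.trace ℚ K (β * α i) = 0 := congrFun (LinearMap.mem_ker.1 hβ) i
  have h2 : β * ((x i : K) * α i) = (x i) • (β * α i) := by rw [zsmul_eq_mul]; ring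
  rw [h2, map_zsmul, h1, smul_zero]

/-- The conclusion for the solutions in a fixed class modulo units. -/
lemma exists_finite_of_class [IsGalois ℚ K] (hdeg : Module.finrank ℚ K = 6)
    (htc : ∀ φ : K →+* ℂ, ¬ ComplexEmbedding.IsReal φ) {β δ : K} (hβ : β ≠ 0) (hδ : δ ≠ 0) :
    ∃ S : Set ((K ≃ₐ[ℚ] K) × (K ≃ₐ[ℚ] K) × K), S.Finite ∧
      (∀ p ∈ S, p.1 ≠ p.2.1 ∧ p.2.2 ≠ 0) ∧
      ∀ v : K, IsIntegralUnit v → Algebra.trace ℚ K (β * (δ * v)) = 0 →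
        ∃ p ∈ S, p.1 (δ * v) = p.2.2 * p.2.1 (δ * v) := by
  obtain ⟨φ⟩ := (inferInstance : Nonempty (K →+* ℂ))
  obtain ⟨c, hφc⟩ := exists_algEquiv_of_embeddings φ (ComplexEmbedding.conjugate φ)
  have hconj : ∀ x, φ (c x) = starRingEnd ℂ (φ x) := fun x => by
    rw [← hφc]; rfl
  have hc1 : c ≠ 1 := by
    rintro rfl
    exact htc φ (RingHom.ext fun x => by rw [hφc]; rfl)
  have hccx : ∀ x, c (c x) = x := fun x => φ.injective (by simp [hconj])
  have hcc : c * c = 1 := AlgEquiv.ext hccx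
  have hG : Nat.card (K ≃ₐ[ℚ] K) = 6 := by rw [IsGalois.card_aut_eq_finrank, hdeg]
  obtain ⟨r, hr3, hcomm, hbij⟩ := exists_pow_three_of_card_eq_six hG hc1 hcc
  have hrx : ∀ x, r (r (r x)) = x := fun x => by
    have := congrArg (fun g : K ≃ₐ[ℚ] K => g x) hr3
    simpa [pow_succ, AlgEquiv.mul_apply] using this
  rcases hcomm with hcomm | hcomm
  · have hcg : ∀ (g : K ≃ₐ[ℚ] K) (x : K), c (g x) = g (c x) := by
      intro g x
      obtain ⟨⟨i, j⟩, rfl⟩ := hbij.2 g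
      have h1 : Commute c r := hcomm
      have h2 : Commute c (c ^ (i : ℕ) * r ^ (j : ℕ)) :=
        ((Commute.refl c).pow_right _).mul_right (h1.pow_right _)
      exact congrArg (fun g : K ≃ₐ[ℚ] K => g x) h2
    have hfin := finite_setOf_house_le (K := K) 1
    refine ⟨(fun x => ((1 : K ≃ₐ[ℚ] K), c, δ / c δ * x)) ''
      ({x : K | IsIntegral ℤ x ∧ house x ≤ 1} \ {0}), (hfin.sdiff).image _, ?_, fun v hv _ => ?_⟩
    · rintro _ ⟨x, hx, rfl⟩
      exact ⟨hc1.symm, mul_ne_zero (div_ne_zero hδ (by simpa using hδ)) hx.2⟩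
    · have hcv : c v ≠ 0 := by simpa using hv.1
      have hcδ : c δ ≠ 0 := by simpa using hδ
      refine ⟨_, ⟨v / c v, ⟨⟨?_, ?_⟩, div_ne_zero hv.1 hcv⟩, rfl⟩, ?_⟩
      · rw [div_eq_mul_inv]; exact (hv.mul (hv.map c).inv).2.1
      · refine house_le_of_forall_norm_le fun ψ => ?_
        obtain ⟨g, hg⟩ := exists_algEquiv_of_embeddings φ ψ
        rw [hg, map_div₀, ← hcg, map_div₀, hconj, norm_div, RCLike.norm_conj]
        exact div_self_le_one _
      · simp only [AlgEquiv.one_apply, map_mul]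
        field_simp
  · have F : IsDihedralFrame φ c r := by
      refine ⟨hconj, hrx, fun x => ?_, fun {x H} h0 h1 h2 => house_le_of_forall_norm_le fun ψ => ?_⟩
      · have := congrArg (fun g : K ≃ₐ[ℚ] K => g x) hcomm
        simpa [pow_two, AlgEquiv.mul_apply] using this
      · obtain ⟨g, hg⟩ := exists_algEquiv_of_embeddings φ ψ
        obtain ⟨⟨i, j⟩, rfl⟩ := hbij.2 g
        rw [hg]
        fin_cases i <;> fin_cases j <;>
          simpa [pow_two, AlgEquiv.mul_apply, hconj] using by first | exact h0 | exact h1 | exact h2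
    obtain ⟨S, hS, hS1, hS2⟩ := F.exists_finite (mul_ne_zero hβ hδ) hδ hc1
    refine ⟨S, hS, hS1, fun v hv htr => hS2 v hv ?_⟩
    have h1 := trace_eq_sum_automorphisms (K := ℚ) (β * (δ * v))
    rw [htr, map_zero, ← hbij.sum_comp (fun g : K ≃ₐ[ℚ] K => g (β * (δ * v)))] at h1
    simp only [Fintype.sum_prod_type, Fin.sum_univ_succ, ← mul_assoc β] at h1
    simp [pow_two, AlgEquiv.mul_apply, -map_mul] at h1
    linear_combination -h1

end NormForm

/-- **Theorem 2 (norm-form equations over totally complex Galois sextic fields).**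
Let `K` be a totally complex Galois number field of degree `6` over `ℚ`, let
`α₁, …, α₅ ∈ K` be `ℚ`-linearly independent elements whose ratios `αⱼ/α_k` generate `K`
over `ℚ`, and let `m` be a nonzero integer. Then there exist an effective constant `C`
and a finite set `S` of triples `(σ, τ, γ)` with `σ ≠ τ` in `Gal(K/ℚ)` and `γ ∈ K`
nonzero, such that every solution of `N_{K/ℚ}(x₁α₁ + ⋯ + x₅α₅) = m` with `max|xᵢ| > C`
satisfies `σ(u) = γ·τ(u)` for some `(σ, τ, γ) ∈ S`, where `u = x₁α₁ + ⋯ + x₅α₅`. -/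
theorem normform_sextic_effective
    (K : Type*) [Field K] [NumberField K] [IsGalois ℚ K]
    (hdeg : Module.finrank ℚ K = 6)
    (htc : ∀ φ : K →+* ℂ, ¬ ComplexEmbedding.IsReal φ)
    (α : Fin 5 → K) (hli : LinearIndependent ℚ α)
    (hgen : IntermediateField.adjoin ℚ {x : K | ∃ i j, x = α i / α j} = ⊤)
    (m : ℤ) (hm : m ≠ 0) :
    ∃ (C : ℝ) (S : Set ((K ≃ₐ[ℚ] K) × (K ≃ₐ[ℚ] K) × K)), S.Finite ∧
      (∀ p ∈ S, p.1 ≠ p.2.1 ∧ p.2.2 ≠ 0) ∧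
      ∀ x : Fin 5 → ℤ,
        Algebra.norm ℚ (∑ i, (x i : K) * α i) = (m : ℚ) →
        C < ((Finset.univ.sup fun i => (x i).natAbs : ℕ) : ℝ) →
        ∃ p ∈ S, p.1 (∑ i, (x i : K) * α i) = p.2.2 * p.2.1 (∑ i, (x i : K) * α i) := by
  obtain ⟨β, hβ, htr⟩ := exists_ne_zero_trace_eq_zero α (by simp [hdeg])
  obtain ⟨Δ, hΔ, hΔ0, hrep⟩ := exists_finite_representatives α hm
  choose! S hS hS1 hS2 using fun δ hδ => exists_finite_of_class hdeg htc hβ (hΔ0 δ hδ)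
  refine ⟨0, ⋃ δ ∈ Δ, S δ, hΔ.biUnion hS, fun p hp => ?_, fun x hx _ => ?_⟩
  · simp only [Set.mem_iUnion] at hp
    obtain ⟨δ, hδ, hp⟩ := hp
    exact hS1 δ hδ p hp
  · obtain ⟨δ, hδ, v, hv, hu⟩ := hrep x hx
    have h1 := htr x
    rw [hu] at h1 ⊢
    obtain ⟨p, hp, he⟩ := hS2 δ hδ v hv h1
    exact ⟨p, Set.mem_biUnion hδ hp, he⟩
end

section
/- Let K be a totally complex number field that is Galois over ℚ with [K : ℚ] ≥ 6, let α be a primitive element of K (so K = ℚ(α)), and let m be a nonzero integer. Then there exist a real constant C and a finite set S of triples (σ, τ, γ), where σ, τ are distinct elements of Gal(K/ℚ) and γ ∈ K is nonzero, such that every solution (x₁, x₂, x₃, x₄) ∈ ℤ⁴ of N_{K/ℚ}(x₁ + x₂α + x₃α² + x₄α³) = m with max{|x₁|, |x₂|, |x₃|, |x₄|} > C satisfies σ(u) = γ·τ(u) for some (σ, τ, γ) ∈ S, where u = x₁ + x₂α + x₃α² + x₄α³. -/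
open NumberField

/-- A real cubic polynomial is controlled by its values at two non-real points that are neither
equal nor complex conjugate. -/
theorem exists_norm_le_mul_max_norm_eval {a b : ℂ} (ha : a.im ≠ 0) (hb : b.im ≠ 0)
    (hab : a ≠ b) (hab' : a ≠ star b) :
    ∃ κ : ℝ, ∀ x : Fin 4 → ℝ,
      ‖x‖ ≤ κ * max ‖∑ i, (x i : ℂ) * a ^ (i : ℕ)‖ ‖∑ i, (x i : ℂ) * b ^ (i : ℕ)‖ := by
  let e (z : ℂ) : (Fin 4 → ℝ) →ₗ[ℝ] ℂ :=
    ∑ i : Fin 4, (LinearMap.proj (R := ℝ) (φ := fun _ : Fin 4 => ℝ) i).smulRight (z ^ (i : ℕ))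
  have he (z : ℂ) (x : Fin 4 → ℝ) : e z x = ∑ i, (x i : ℂ) * z ^ (i : ℕ) := by
    simp [e]
  have hstar (z : ℂ) (x : Fin 4 → ℝ) : e (star z) x = star (e z x) := by
    simp [he]
  have hinj : LinearMap.ker ((e a).prod (e b)) = ⊥ := by
    refine LinearMap.ker_eq_bot'.2 fun x hx => ?_
    obtain ⟨hxa, hxb⟩ : e a x = 0 ∧ e b x = 0 := by simpa using hx
    have hne {z : ℂ} (hz : z.im ≠ 0) : z ≠ star z := fun h =>
      hz (Complex.conj_eq_iff_im.1 h.symm)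
    have hf : Function.Injective ![a, star a, b, star b] := by
      have h1 := hne ha
      have h2 := hne hb
      have h3 : star a ≠ star b := fun h => hab (star_injective h)
      have h4 : star a ≠ b := fun h => hab' (by rw [← h, star_star])
      intro i j hij
      fin_cases i <;> fin_cases j <;> simp_all [eq_comm]
    have h0 : (fun i => (x i : ℂ)) = 0 := by
      refine Matrix.eq_zero_of_forall_index_sum_mul_pow_eq_zero hf fun j => ?_
      have : e (![a, star a, b, star b] j) x = 0 := by
        fin_cases j
        · exact hxa
        · exact (hstar a x).trans (by rw [hxa, star_zero])
        · exact hxb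
        · exact (hstar b x).trans (by rw [hxb, star_zero])
      simpa [he, mul_comm] using this
    ext i
    simpa using congrFun h0 i
  obtain ⟨κ, -, hκ⟩ := LinearMap.exists_antilipschitzWith _ hinj
  refine ⟨κ, fun x => ?_⟩
  simpa [he, Prod.norm_def, dist_eq_norm] using hκ.le_mul_dist x 0

/-- If `y` is integral over `ℤ` with norm `M`, then `M` is a denominator of `y / σ y`. -/
theorem isIntegral_norm_mul_div {K : Type*} [Field K] [NumberField K] [IsGalois ℚ K]
    {y : K} (hy : IsIntegral ℤ y) (hy0 : y ≠ 0) (σ : K ≃ₐ[ℚ] K) :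
    IsIntegral ℤ (algebraMap ℚ K (Algebra.norm ℚ y) * (y / σ y)) := by
  classical
  have hσ : σ y ≠ 0 := by simpa using hy0
  rw [Algebra.norm_eq_prod_automorphisms, ← Finset.mul_prod_erase _ _ (Finset.mem_univ σ),
    show ∀ p : K, σ y * p * (y / σ y) = p * y by intro p; field_simp]
  refine (IsIntegral.prod _ fun τ _ => ?_).mul hy
  exact hy.map (τ.toAlgHom.restrictScalars ℤ)

namespace NumberField

variable {K : Type*} [Field K] [NumberField K]

/-- For a totally complex field, the value at `α` of a polynomial of degree at most three with
real coefficients is small under at most one pair of conjugate embeddings. -/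
theorem exists_norm_le_mul_max_norm_embedding
    (htc : ∀ φ : K →+* ℂ, ¬ ComplexEmbedding.IsReal φ) {α : K}
    (hprim : IntermediateField.adjoin ℚ {α} = ⊤) :
    ∃ κ : ℝ, ∀ φ ψ : K →+* ℂ, ψ ≠ φ → ψ ≠ ComplexEmbedding.conjugate φ → ∀ x : Fin 4 → ℝ,
      ‖x‖ ≤ κ * max ‖∑ i, (x i : ℂ) * ψ α ^ (i : ℕ)‖ ‖∑ i, (x i : ℂ) * φ α ^ (i : ℕ)‖ := by
  have hadj : Algebra.adjoin ℚ {α} = ⊤ := by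
    rw [← IntermediateField.adjoin_simple_toSubalgebra_of_isAlgebraic
      (Algebra.IsAlgebraic.isAlgebraic α), hprim, IntermediateField.top_toSubalgebra]
  have hinj {φ ψ : K →+* ℂ} (h : ψ α = φ α) : ψ = φ := by
    have : ψ.toRatAlgHom = φ.toRatAlgHom :=
      AlgHom.ext_of_adjoin_eq_top hadj (by simpa using h)
    ext z
    exact DFunLike.congr_fun this z
  have him (φ : K →+* ℂ) : (φ α).im ≠ 0 := fun h =>
    htc φ (ComplexEmbedding.isReal_iff.2 (hinj (Complex.conj_eq_iff_im.2 h)))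
  have key (p : (K →+* ℂ) × (K →+* ℂ)) : ∃ κ : ℝ, p.2 ≠ p.1 →
      p.2 ≠ ComplexEmbedding.conjugate p.1 → ∀ x : Fin 4 → ℝ,
      ‖x‖ ≤ κ * max ‖∑ i, (x i : ℂ) * p.2 α ^ (i : ℕ)‖ ‖∑ i, (x i : ℂ) * p.1 α ^ (i : ℕ)‖ := by
    by_cases h : p.2 ≠ p.1 ∧ p.2 ≠ ComplexEmbedding.conjugate p.1
    · obtain ⟨κ, hκ⟩ := exists_norm_le_mul_max_norm_eval (him p.2) (him p.1)
        (fun h' => h.1 (hinj h')) (fun h' => h.2 (hinj h'))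
      exact ⟨κ, fun _ _ => hκ⟩
    · exact ⟨0, fun h1 h2 => (h ⟨h1, h2⟩).elim⟩
  choose κ hκ using key
  obtain ⟨M, hM⟩ := Finite.exists_le κ
  refine ⟨M, fun φ ψ h1 h2 x => (hκ (φ, ψ) h1 h2 x).trans ?_⟩
  gcongr
  exact hM (φ, ψ)

/-- Under every embedding, the value at `α` of a polynomial of degree at most three with real
coefficients is bounded by a multiple of the largest coefficient. -/
theorem exists_norm_embedding_le_mul (α : K) :
    ∃ B : ℝ, ∀ (φ : K →+* ℂ) (x : Fin 4 → ℝ),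
      ‖∑ i, (x i : ℂ) * φ α ^ (i : ℕ)‖ ≤ B * ‖x‖ := by
  obtain ⟨B, hB⟩ := Finite.exists_le fun φ : K →+* ℂ => ∑ i : Fin 4, ‖φ α‖ ^ (i : ℕ)
  refine ⟨B, fun φ x => le_trans ?_ (mul_le_mul_of_nonneg_right (hB φ) (norm_nonneg x))⟩
  rw [Finset.sum_mul]
  refine norm_sum_le_of_le _ fun i _ => ?_
  rw [norm_mul, norm_pow, Complex.norm_real, mul_comm]
  gcongr
  exact norm_le_pi_norm x i

/-- The value `u` at `α` of a nonzero integral polynomial of degree at most three has bounded ratio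
to its conjugate `σ u`, under all embeddings, for a suitable complex conjugation `σ`. -/
theorem exists_norm_div_le [IsGalois ℚ K]
    (htc : ∀ φ : K →+* ℂ, ¬ ComplexEmbedding.IsReal φ) {α : K}
    (hprim : IntermediateField.adjoin ℚ {α} = ⊤) :
    ∃ R : ℝ, ∀ x : Fin 4 → ℤ, ∑ i, (x i : K) * α ^ (i : ℕ) ≠ 0 →
      ∃ σ : K ≃ₐ[ℚ] K, σ ≠ 1 ∧ ∀ ψ : K →+* ℂ,
        ‖ψ ((∑ i, (x i : K) * α ^ (i : ℕ)) / σ (∑ i, (x i : K) * α ^ (i : ℕ)))‖ ≤ R := by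
  obtain ⟨κ, hκ⟩ := exists_norm_le_mul_max_norm_embedding htc hprim
  obtain ⟨B, hB⟩ := exists_norm_embedding_le_mul α
  refine ⟨max 1 (B * κ), fun x => ?_⟩
  set u := ∑ i, (x i : K) * α ^ (i : ℕ) with hu
  intro hu0
  set X : Fin 4 → ℝ := fun i => (x i : ℝ)
  have hφu (φ : K →+* ℂ) : ∑ i, (X i : ℂ) * φ α ^ (i : ℕ) = φ u := by simp [hu, X]
  obtain ⟨φ, hφ⟩ := Finite.exists_min fun φ : K →+* ℂ => ‖φ u‖
  have hlow (ψ : K →+* ℂ) (h1 : ψ ≠ φ) (h2 : ψ ≠ ComplexEmbedding.conjugate φ) :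
      ‖X‖ ≤ κ * ‖ψ u‖ := by
    have := hκ φ ψ h1 h2 X
    rwa [hφu, hφu, max_eq_left (hφ ψ)] at this
  obtain ⟨σ, hσ⟩ : ∃ σ : K ≃ₐ[ℚ] K, ComplexEmbedding.IsConj φ σ := by
    obtain ⟨σ, hσ⟩ := ComplexEmbedding.exists_comp_symm_eq_of_comp_eq (k := ℚ) φ
      (ComplexEmbedding.conjugate φ) (Subsingleton.elim _ _)
    exact ⟨σ.symm, hσ.symm⟩
  have hcomp {ψ : K →+* ℂ} : ψ.comp (σ : K →+* K) = φ → ψ = ComplexEmbedding.conjugate φ := by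
    rintro rfl
    ext z
    have := hσ.symm.eq z
    simp at this
    simpa using this
  refine ⟨σ, ?_, fun ψ => ?_⟩
  · rintro rfl
    exact htc φ (ComplexEmbedding.isConj_one_iff.1 hσ)
  have hσu (ψ : K →+* ℂ) : ψ (σ u) ≠ 0 := by simpa using hu0
  have hφσ : ‖φ (σ u)‖ = ‖φ u‖ := by rw [hσ.eq, norm_star]
  rw [map_div₀, norm_div, div_le_iff₀ (norm_pos_iff.2 (hσu ψ))]
  by_cases h1 : ψ = φ
  · rw [h1, hφσ]
    exact le_mul_of_one_le_left (norm_nonneg _) (le_max_left _ _)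
  by_cases h2 : ψ = ComplexEmbedding.conjugate φ
  · rw [h2, ComplexEmbedding.conjugate_coe_eq, ComplexEmbedding.conjugate_coe_eq,
      RCLike.norm_conj, RCLike.norm_conj, hφσ]
    exact le_mul_of_one_le_left (norm_nonneg _) (le_max_left _ _)
  have h3 : ψ.comp (σ : K →+* K) ≠ φ := fun h => h2 (hcomp h)
  have h4 : ψ.comp (σ : K →+* K) ≠ ComplexEmbedding.conjugate φ := fun h => h1 <| by
    ext z
    have := RingHom.congr_fun h (σ.symm z)
    rw [ComplexEmbedding.conjugate_coe_eq, hσ.symm.eq] at this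
    simpa using this
  have hB0 : 0 ≤ B * ‖X‖ := (norm_nonneg _).trans (hB φ X)
  have hX : 0 < ‖X‖ := by
    refine norm_pos_iff.2 fun h => hu0 ((map_eq_zero φ).1 ?_)
    rw [← hφu, h]
    simp
  have hBnn : 0 ≤ B := nonneg_of_mul_nonneg_left hB0 hX
  calc ‖ψ u‖ ≤ B * ‖X‖ := hφu ψ ▸ hB ψ X
    _ ≤ B * (κ * ‖ψ (σ u)‖) := by gcongr; exact hlow _ h3 h4
    _ = B * κ * ‖ψ (σ u)‖ := (mul_assoc _ _ _).symm
    _ ≤ _ := by gcongr; exact le_max_right _ _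

end NumberField

/-- **Theorem 3 (power-basis norm-form equations in four variables).**
Let `K` be a totally complex Galois number field with `[K : ℚ] ≥ 6`, let `α` be a
primitive element of `K` (so `K = ℚ(α)`), and let `m` be a nonzero integer. Then there
exist an effective constant `C` and a finite set `S` of triples `(σ, τ, γ)` with `σ ≠ τ`
in `Gal(K/ℚ)` and `γ ∈ K` nonzero, such that every solution of
`N_{K/ℚ}(x₁ + x₂α + x₃α² + x₄α³) = m` with `max|xᵢ| > C` satisfies `σ(u) = γ·τ(u)` for
some `(σ, τ, γ) ∈ S`, where `u = x₁ + x₂α + x₃α² + x₄α³`. -/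
theorem normform_power_basis_effective
    (K : Type*) [Field K] [NumberField K] [IsGalois ℚ K]
    (hdeg : 6 ≤ Module.finrank ℚ K)
    (htc : ∀ φ : K →+* ℂ, ¬ ComplexEmbedding.IsReal φ)
    (α : K) (hprim : IntermediateField.adjoin ℚ {α} = ⊤)
    (m : ℤ) (hm : m ≠ 0) :
    ∃ (C : ℝ) (S : Set ((K ≃ₐ[ℚ] K) × (K ≃ₐ[ℚ] K) × K)), S.Finite ∧
      (∀ p ∈ S, p.1 ≠ p.2.1 ∧ p.2.2 ≠ 0) ∧
      ∀ x : Fin 4 → ℤ,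
        Algebra.norm ℚ (∑ i, (x i : K) * α ^ (i : ℕ)) = (m : ℚ) →
        C < ((Finset.univ.sup fun i => (x i).natAbs : ℕ) : ℝ) →
        ∃ p ∈ S, p.1 (∑ i, (x i : K) * α ^ (i : ℕ)) =
          p.2.2 * p.2.1 (∑ i, (x i : K) * α ^ (i : ℕ)) := by
  obtain ⟨R, hR⟩ := NumberField.exists_norm_div_le htc hprim
  obtain ⟨D, hD0, hD⟩ := ((IsFractionRing.isAlgebraic_iff ℤ ℚ K).2
    (Algebra.IsAlgebraic.isAlgebraic α)).exists_integral_multiple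
  set M : ℚ := ((D : ℚ) ^ 3) ^ Module.finrank ℚ K * m
  have hM0 : algebraMap ℚ K M ≠ 0 := by
    rw [Ne, map_eq_zero]
    positivity
  set T : Set K := {γ | IsIntegral ℤ (algebraMap ℚ K M * γ) ∧
    ∀ φ : K →+* ℂ, ‖φ (algebraMap ℚ K M * γ)‖ ≤ |(M : ℝ)| * R}
  have hT : T.Finite := (Embeddings.finite_of_norm_le K ℂ (|(M : ℝ)| * R)).preimage
    (mul_right_injective₀ hM0).injOn
  refine ⟨0, {p | p.1 ≠ p.2.1 ∧ p.2.2 ≠ 0 ∧ p.2.2 ∈ T}, ?_, fun p hp => ⟨hp.1, hp.2.1⟩, ?_⟩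
  · exact (Set.finite_univ.prod (Set.finite_univ.prod hT)).subset fun p hp =>
      ⟨trivial, trivial, hp.2.2⟩
  intro x hx _
  have hu0 : ∑ i, (x i : K) * α ^ (i : ℕ) ≠ 0 := by
    intro h
    rw [h, Algebra.norm_zero] at hx
    exact hm (by exact_mod_cast hx.symm)
  obtain ⟨σ, hσ1, hσ⟩ := hR x hu0
  have hint : IsIntegral ℤ ((D : K) ^ 3 * ∑ i, (x i : K) * α ^ (i : ℕ)) := by
    rw [Finset.mul_sum]
    refine IsIntegral.sum _ fun i _ => ?_
    have : (D : K) ^ 3 * ((x i : K) * α ^ (i : ℕ)) =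
        ((D ^ (3 - (i : ℕ)) * x i : ℤ) : K) * (D • α) ^ (i : ℕ) := by
      rw [zsmul_eq_mul, mul_pow, ← Nat.sub_add_cancel (show (i : ℕ) ≤ 3 by lia), pow_add]
      push_cast
      simp only [Nat.add_sub_cancel]
      ring
    rw [this]
    exact (isIntegral_algebraMap (R := ℤ) (A := K)).mul (hD.pow _)
  set u := ∑ i, (x i : K) * α ^ (i : ℕ)
  have hσu : σ u ≠ 0 := by simpa using hu0
  have hDK : (D : K) ≠ 0 := by exact_mod_cast hD0
  refine ⟨(1, σ, u / σ u), ⟨hσ1.symm, div_ne_zero hu0 hσu, ?_, fun φ => ?_⟩, ?_⟩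
  · have := isIntegral_norm_mul_div hint (mul_ne_zero (pow_ne_zero 3 hDK) hu0) σ
    have hnorm : Algebra.norm ℚ ((D : K) ^ 3 * u) = M := by
      have : (D : K) ^ 3 = algebraMap ℚ K ((D : ℚ) ^ 3) := by simp
      rw [map_mul, hx, this, Algebra.norm_algebraMap]
    rwa [hnorm, map_mul σ, map_pow σ, map_intCast σ,
      mul_div_mul_left _ _ (pow_ne_zero 3 hDK)] at this
  · rw [map_mul, norm_mul]
    have : ‖φ (algebraMap ℚ K M)‖ = |(M : ℝ)| := by simp
    rw [this]
    gcongr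
    exact hσ φ
  · simp [div_mul_cancel₀ _ hσu]
end
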